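/- Assume V⁺ ∈ L¹ and assumption (i): ℙ{V(ω,z) ≥ 0} = 1 for all z ∈ R₀ and there exists c ∈ ℝ with ℙ{V(ω,z) ≥ c} = 1 for all z ∈ R∖R₀. Fix a face A ≠ {0} of C₊, let R' = R ∩ A, and assume V⁺(·,z) ∈ L_{z,R'} for each z ∈ R'∖{0} and V⁺(·,0) ∈ L_{ẑ,R'} for some ẑ ∈ R'∖{0}. Assume in addition that either the p-random walk is transient (P₀(τ₀ < ∞) < 1) or there exists ε > 0 with E[R_ε^d] < ∞. Let α be the process on relint A characterized ℙ-a.s. by α(ξ) = lim_{n→∞} a(0,x_n)/n for sequences x_n ∈ G₊ ∩ A with x_n/n → ξ. Then ℙ-almost surely, for every δ > 0: limsup over x ∈ G₊ ∩ A_δ with |x|₁ → ∞ of |log g(0,x) + α(x)|/|x|₁ equals 0. -/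

import Mathlib

open MeasureTheory Filter Set
open scoped ENNReal NNReal Classical Topology

noncomputable section

namespace RWRP

abbrev Zd (d : ℕ) := Fin d → ℤ

variable {d : ℕ} {Ω : Type*} {Γ : Type*}

/-- Embedding of `ℤ^d` into `ℝ^d`. -/
def toR (x : Zd d) : Fin d → ℝ := fun i => (x i : ℝ)

/-- The `ℓ¹` norm on `ℝ^d`. -/
def n1 (ξ : Fin d → ℝ) : ℝ := ∑ i, |ξ i|

/-- The `ℓ¹` norm of a lattice point. -/
def n1Z (x : Zd d) : ℝ := n1 (toR x)

/-- `G₊`: the additive semigroup (ℤ₊-combinations) generated by the step set. -/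
def Gp (R : Finset (Zd d)) : Set (Zd d) := {x | ∃ b : Zd d → ℕ, x = ∑ z ∈ R, b z • z}

/-- `G(R')`: the additive group (ℤ-combinations) generated by `R'`. -/
def GZ (R : Finset (Zd d)) : Set (Zd d) := {x | ∃ b : Zd d → ℤ, x = ∑ z ∈ R, b z • z}

/-- ℤ₊-combinations of elements of a set of lattice points. -/
def GpS (S : Set (Zd d)) : Set (Zd d) :=
  {x | ∃ (m : ℕ) (c : Fin m → Zd d), (∀ i, c i ∈ S) ∧ x = ∑ i, c i}

/-- `C₊`: the real cone generated by the step set. -/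
def Cp (R : Finset (Zd d)) : Set (Fin d → ℝ) :=
  {ξ | ∃ b : Zd d → ℝ, (∀ z, 0 ≤ b z) ∧ ξ = ∑ z ∈ R, b z • toR z}

/-- `C'₊`: the rational cone generated by the step set. -/
def CpQ (R : Finset (Zd d)) : Set (Fin d → ℝ) :=
  {ξ | ∃ b : Zd d → ℚ, (∀ z, 0 ≤ b z) ∧ ξ = ∑ z ∈ R, (b z : ℝ) • toR z}

/-- `A` is a face of the convex set `K`. -/
def IsFace (K A : Set (Fin d → ℝ)) : Prop :=
  A ⊆ K ∧ Convex ℝ A ∧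
    ∀ ⦃ξ ζ η : Fin d → ℝ⦄ ⦃t : ℝ⦄, ξ ∈ A → ζ ∈ K → η ∈ K → t ∈ Set.Ioo (0:ℝ) 1 →
      ξ = t • ζ + (1 - t) • η → ζ ∈ A ∧ η ∈ A

/-- `U`: the convex hull of the step set. -/
def hullU (R : Finset (Zd d)) : Set (Fin d → ℝ) := convexHull ℝ (toR '' (R : Set (Zd d)))

/-- `U₀` is the face of `U` containing `0` in its relative interior (the empty set if `0 ∉ U`). -/
def IsZeroFace (R : Finset (Zd d)) (U₀ : Set (Fin d → ℝ)) : Prop :=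
  ((0 : Fin d → ℝ) ∈ hullU R ∧ IsFace (hullU R) U₀ ∧
    (0 : Fin d → ℝ) ∈ intrinsicInterior ℝ U₀) ∨
  ((0 : Fin d → ℝ) ∉ hullU R ∧ U₀ = ∅)

/-- `R₀ = R ∩ U₀`. -/
def R0 (R : Finset (Zd d)) (U₀ : Set (Fin d → ℝ)) : Set (Zd d) := {z | z ∈ R ∧ toR z ∈ U₀}

/-- `A_δ`: the directions in the face `A` at ℓ¹ distance `≥ δ` (after normalization) from the
relative boundary of `A`. -/
def faceDelta (A : Set (Fin d → ℝ)) (δ : ℝ) : Set (Fin d → ℝ) :=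
  {ξ | ξ ∈ A ∧ ξ ≠ 0 ∧
    ENNReal.ofReal δ ≤ ⨅ (η : Fin d → ℝ) (_ : η ∈ A \ intrinsicInterior ℝ A),
      ENNReal.ofReal (n1 ((n1 ξ)⁻¹ • ξ - η))}

/-- `U'_δ = {ξ ∈ U' : dist(ξ, U' ∖ relint Uall) ≥ δ}`. -/
def faceDeltaU (Uall U' : Set (Fin d → ℝ)) (δ : ℝ) : Set (Fin d → ℝ) :=
  {ξ | ξ ∈ U' ∧
    ENNReal.ofReal δ ≤ ⨅ (η : Fin d → ℝ) (_ : η ∈ U' \ intrinsicInterior ℝ Uall),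
      ENNReal.ofReal (n1 (ξ - η))}

/-- `D_n`: points reachable in exactly `n` admissible steps (counted with multiplicities). -/
def Dn (R : Finset (Zd d)) (n : ℕ) : Set (Zd d) :=
  {x | ∃ b : Zd d → ℕ, (∑ z ∈ R, b z) = n ∧ x = ∑ z ∈ R, b z • z}

/-- Position after `k` steps of the path with increments `f`, started at `x`. -/
def pos (x : Zd d) (f : ℕ → Zd d) (k : ℕ) : Zd d := x + ∑ i ∈ Finset.range k, f i

/-- Convert a finite tuple of admissible steps to an increment sequence. -/
def stepF {R : Finset (Zd d)} (n : ℕ) (s : Fin n → {z : Zd d // z ∈ R}) : ℕ → Zd d :=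
  fun i => if h : i < n then (s ⟨i, h⟩ : Zd d) else 0

/-- The path started at `x` with increments `f` hits `y` for the first time (after time `0`)
at time `n`. -/
def firstHit (x y : Zd d) (n : ℕ) (f : ℕ → Zd d) : Prop :=
  pos x f n = y ∧ ∀ k ∈ Finset.Ioo 0 n, pos x f k ≠ y

/-- Probability weight of a tuple of steps under the random walk kernel `p`. -/
def pathW (p : Zd d → ℝ) {R : Finset (Zd d)} {n : ℕ} (s : Fin n → {z : Zd d // z ∈ R}) : ℝ≥0∞ :=
  ∏ i, ENNReal.ofReal (p (s i : Zd d))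

/-- Total potential collected along the first `n` steps of a path. -/
def pathV (T : Zd d → Ω → Ω) (V : Ω → Zd d → ℝ) (ω : Ω) (x : Zd d) (n : ℕ)
    (f : ℕ → Zd d) : ℝ :=
  ∑ i ∈ Finset.range n, V (T (pos x f i) ω) (f i)

/-- `E_x[exp(-∑_{k<τ_y} V(T_{X_k}ω, Z_{k+1})) 1{τ_y < ∞}]`, as a sum over killed paths. -/
def walkK (T : Zd d → Ω → Ω) (V : Ω → Zd d → ℝ) (p : Zd d → ℝ) (R : Finset (Zd d))
    (ω : Ω) (x y : Zd d) : ℝ≥0∞ :=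
  ∑' n : ℕ, ∑ s : Fin (n+1) → {z : Zd d // z ∈ R},
    if firstHit x y (n+1) (stepF (n+1) s) then
      pathW p s * ENNReal.ofReal (Real.exp (-(pathV T V ω x (n+1) (stepF (n+1) s))))
    else 0

/-- The point-to-point quantity `a(ω,x,y)` (real-valued version, with junk values where the
underlying expectation is `0` or `∞`). -/
def aFun (T : Zd d → Ω → Ω) (V : Ω → Zd d → ℝ) (p : Zd d → ℝ) (R : Finset (Zd d))
    (ω : Ω) (x y : Zd d) : ℝ :=
  if y = x then 0 else - Real.log ((walkK T V p R ω x y).toReal)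

/-- The point-to-point quantity `a(ω,x,y)` with values in `[-∞,∞]`. -/
def aE (T : Zd d → Ω → Ω) (V : Ω → Zd d → ℝ) (p : Zd d → ℝ) (R : Finset (Zd d))
    (ω : Ω) (x y : Zd d) : EReal :=
  if y = x then (0 : EReal) else - (ENNReal.log (walkK T V p R ω x y))

/-- The zero-temperature quantity `a_∞(ω,x,y)`: the infimum of the total potential over
admissible paths from `x` to `y` that hit `y` for the first time at their last step. -/
def aInf (T : Zd d → Ω → Ω) (V : Ω → Zd d → ℝ) (R : Finset (Zd d))
    (ω : Ω) (x y : Zd d) : ℝ :=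
  if y = x then 0 else
    sInf {v : ℝ | ∃ n : ℕ, ∃ s : Fin (n+1) → {z : Zd d // z ∈ R},
      firstHit x y (n+1) (stepF (n+1) s) ∧ v = pathV T V ω x (n+1) (stepF (n+1) s)}

/-- The Green's function `g(ω,x,y)`, with values in `[0,∞]`. -/
def greenK (T : Zd d → Ω → Ω) (V : Ω → Zd d → ℝ) (p : Zd d → ℝ) (R : Finset (Zd d))
    (ω : Ω) (x y : Zd d) : ℝ≥0∞ :=
  (if y = x then 1 else 0) +
  ∑' n : ℕ, ∑ s : Fin (n+1) → {z : Zd d // z ∈ R},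
    if pos x (stepF (n+1) s) (n+1) = y then
      pathW p s * ENNReal.ofReal (Real.exp (-(pathV T V ω x (n+1) (stepF (n+1) s))))
    else 0

/-- `E_x[exp(-∑_{k<n} V) 1{X_n = y}]`: the restricted-length partition function. -/
def resK (T : Zd d → Ω → Ω) (V : Ω → Zd d → ℝ) (p : Zd d → ℝ) (R : Finset (Zd d))
    (ω : Ω) (n : ℕ) (x y : Zd d) : ℝ≥0∞ :=
  ∑ s : Fin n → {z : Zd d // z ∈ R},
    if pos x (stepF n s) n = y then
      pathW p s * ENNReal.ofReal (Real.exp (-(pathV T V ω x n (stepF n s))))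
    else 0

/-- `G_{x,(n),y} = log E_x[exp(-∑_{k<n} V) 1{X_n = y}]`. -/
def GRes (T : Zd d → Ω → Ω) (V : Ω → Zd d → ℝ) (p : Zd d → ℝ) (R : Finset (Zd d))
    (ω : Ω) (n : ℕ) (x y : Zd d) : ℝ :=
  Real.log ((resK T V p R ω n x y).toReal)

/-- The return probability `P₀(τ₀ < ∞)` of the reference walk. -/
def retP (p : Zd d → ℝ) (R : Finset (Zd d)) : ℝ≥0∞ :=
  ∑' n : ℕ, ∑ s : Fin (n+1) → {z : Zd d // z ∈ R},
    if firstHit (0 : Zd d) 0 (n+1) (stepF (n+1) s) then pathW p s else 0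

/-- `R_ε`: the ℓ¹-distance from the origin to the nearest point `x` of `G₊(S)` with
`V(T_x ω, z) ≥ ε` for some `z ∈ S`, as an element of `[0,∞]`. -/
def Reps (T : Zd d → Ω → Ω) (V : Ω → Zd d → ℝ) (S : Set (Zd d)) (ε : ℝ) (ω : Ω) : ℝ≥0∞ :=
  ⨅ (x : Zd d) (_ : x ∈ GpS S ∧ ∃ z ∈ S, ε ≤ V (T x ω) z), ENNReal.ofReal (n1Z x)

/-- The shift maps on a product space. -/
def shiftT (z : Zd d) (ω : Zd d → Γ) : Zd d → Γ := fun y => ω (z + y)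

/-- A function is locally Lipschitz (w.r.t. the ℓ¹ norm) on a set. -/
def LocLipOn (f : (Fin d → ℝ) → ℝ) (S : Set (Fin d → ℝ)) : Prop :=
  ∀ ξ ∈ S, ∃ K ε : ℝ, 0 < ε ∧ ∀ x ∈ S, ∀ y ∈ S,
    n1 (x - ξ) < ε → n1 (y - ξ) < ε → |f x - f y| ≤ K * n1 (x - y)

section measurable

variable [MeasurableSpace Ω]

/-- The σ-algebra of measurable sets invariant under the shifts `{T_z : z ∈ S}`. -/
def invSigma (T : Zd d → Ω → Ω) (S : Set (Zd d)) : MeasurableSpace Ω where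
  MeasurableSet' A := MeasurableSet A ∧ ∀ z ∈ S, T z ⁻¹' A = A
  measurableSet_empty := ⟨MeasurableSet.empty, fun _ _ => by simp⟩
  measurableSet_compl A hA := ⟨hA.1.compl, fun z hz => by
    rw [Set.preimage_compl, hA.2 z hz]⟩
  measurableSet_iUnion f hf := ⟨MeasurableSet.iUnion fun i => (hf i).1, fun z hz => by
    rw [Set.preimage_iUnion]
    exact Set.iUnion_congr fun i => (hf i).2 z hz⟩

/-- `ℙ` is ergodic under the shifts `{T_z : z ∈ S}`. -/
def ErgodicUnder (ℙ : Measure Ω) (T : Zd d → Ω → Ω) (S : Set (Zd d)) : Prop :=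
  ∀ A : Set Ω, MeasurableSet A → (∀ z ∈ S, T z ⁻¹' A = A) → ℙ A = 0 ∨ ℙ A = 1

/-- The class `𝓛_{z,R'}`. -/
def classL (ℙ : Measure Ω) (T : Zd d → Ω → Ω) (g : Ω → ℝ) (z : Zd d)
    (R' : Finset (Zd d)) : Prop :=
  ∀ᵐ ω ∂ℙ,
    (⨅ ε : {e : ℝ // 0 < e},
      Filter.limsup (fun n : ℕ =>
        ⨆ (x : Zd d) (_ : x ∈ Gp R' ∧ n1Z x ≤ n),
          (n : ℝ≥0∞)⁻¹ *
            ∑ k ∈ Finset.range (⌊(ε : ℝ) * n⌋₊ + 1), ENNReal.ofReal (g (T (x + k • z) ω)))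
        Filter.atTop) = 0

/-- Extended conditional expectation, with values in `[-∞,∞]`: the decreasing limit of the
conditional expectations of the truncations `max f (-n)`.  It agrees a.s. with the usual
conditional expectation in `[-∞,∞)` whenever `f⁺` is integrable. -/
def condExpE (ℙ : Measure Ω) (m : MeasurableSpace Ω) (f : Ω → ℝ) : Ω → EReal :=
  fun ω => ⨅ n : ℕ, ((MeasureTheory.condExp m ℙ (fun ω' => max (f ω') (-(n : ℝ))) ω : ℝ) : EReal)

/-- `EReal → ℝ≥0∞`, sending `[-∞,0]` to `0` and `⊤` to `⊤`. -/
def erealToENN (x : EReal) : ℝ≥0∞ := if x = ⊤ then ⊤ else ENNReal.ofReal x.toReal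

/-- `ᾱ(x) = inf_{n ≥ 1} (1/n) E[a(0,nx) | I_x]`, with `ᾱ(0) = 0`. -/
def alphaBar (ℙ : Measure Ω) (T : Zd d → Ω → Ω) (V : Ω → Zd d → ℝ) (p : Zd d → ℝ)
    (R : Finset (Zd d)) (x : Zd d) : Ω → EReal :=
  fun ω =>
    if x = 0 then 0 else
    ⨅ n : {m : ℕ // 0 < m},
      (((n : ℕ) : ℝ)⁻¹ : EReal) *
        condExpE ℙ (invSigma T {x}) (fun ω' => aFun T V p R ω' 0 ((n : ℕ) • x)) ω

/-- `x̂_t(ξ) = ∑_z ⌊tγ_z⌋ z`. -/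
def xhat (R : Finset (Zd d)) (γ : Zd d → ℝ) (t : ℝ) : Zd d := ∑ z ∈ R, ⌊t * γ z⌋ • z

/-- `tilde-α(ξ) = inf_{t ∈ ℚ, t>0} (1/t) E[a(0, x̂_t(ξ)) | 𝔖]`, where `𝔖` is the σ-algebra of
sets invariant under the shifts from `S`. -/
def tAlpha (ℙ : Measure Ω) (T : Zd d → Ω → Ω) (V : Ω → Zd d → ℝ) (p : Zd d → ℝ)
    (R : Finset (Zd d)) (S : Set (Zd d)) (γ : Zd d → ℝ) : Ω → EReal :=
  fun ω => ⨅ t : {q : ℚ // 0 < q},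
    ((((t : ℚ) : ℝ))⁻¹ : EReal) *
      condExpE ℙ (invSigma T S) (fun ω' => aFun T V p R ω' 0 (xhat R γ ((t : ℚ) : ℝ))) ω

/-- The σ-algebra `𝔖_ξ` of sets invariant under the shifts from `R_ξ = R ∩ C_ξ`. -/
def Sface (T : Zd d → Ω → Ω) (R : Finset (Zd d))
    (Cface : (Fin d → ℝ) → Set (Fin d → ℝ)) (ξ : Fin d → ℝ) : MeasurableSpace Ω :=
  invSigma T {z | z ∈ R ∧ toR z ∈ Cface ξ}

/-- `tilde-α` as a function of the direction `ξ`, given a choice `Cface` of the face `C_ξ`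
and a choice `γfun` of cone coefficients. -/
def tAlphaF (ℙ : Measure Ω) (T : Zd d → Ω → Ω) (V : Ω → Zd d → ℝ) (p : Zd d → ℝ)
    (R : Finset (Zd d)) (Cface : (Fin d → ℝ) → Set (Fin d → ℝ))
    (γfun : (Fin d → ℝ) → Zd d → ℝ) (ξ : Fin d → ℝ) : Ω → EReal :=
  fun ω => if ξ = 0 then 0 else tAlpha ℙ T V p R {z | z ∈ R ∧ toR z ∈ Cface ξ} (γfun ξ) ω

/-- `B` is an `L¹` covariant cocycle on the group generated by the allowed steps. -/
def IsCocycle (ℙ : Measure Ω) (T : Zd d → Ω → Ω) (S : Set (Zd d))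
    (B : Ω → Zd d → Zd d → ℝ) : Prop :=
  (∀ x y : Zd d, Measurable fun ω => B ω x y) ∧
  (∀ x ∈ S, ∀ y ∈ S, Integrable (fun ω => B ω x y) ℙ) ∧
  (∀ᵐ ω ∂ℙ, ∀ x ∈ S, ∀ y ∈ S, ∀ z ∈ S, B ω x y + B ω y z = B ω x z) ∧
  (∀ᵐ ω ∂ℙ, ∀ x ∈ S, ∀ y ∈ S, ∀ z ∈ S, B ω (x + z) (y + z) = B (T z ω) x y)

/-- The class `K⁺_A(V)` of centered cocycles. -/
def InKplus (ℙ : Measure Ω) (T : Zd d → Ω → Ω) (V : Ω → Zd d → ℝ) (p : Zd d → ℝ)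
    (R' : Finset (Zd d)) (B : Ω → Zd d → Zd d → ℝ) : Prop :=
  IsCocycle ℙ T (GZ R') B ∧
  ∀ᵐ ω ∂ℙ, ∑ z ∈ R', p z * Real.exp (-(V ω z) - B ω 0 z) ≤ 1

/-- The standing setting: shifts, stationary `ℙ`, finite step set, measurable potential,
random walk kernel. -/
def Setting (ℙ : Measure Ω) (T : Zd d → Ω → Ω) (R : Finset (Zd d))
    (V : Ω → Zd d → ℝ) (p : Zd d → ℝ) : Prop :=
  (∀ z : Zd d, Measurable (T z)) ∧ T 0 = id ∧ (∀ x y : Zd d, T (x + y) = T x ∘ T y) ∧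
  (∀ z : Zd d, MeasurePreserving (T z) ℙ ℙ) ∧ 2 ≤ R.card ∧
  (∀ z : Zd d, Measurable fun ω => V ω z) ∧
  (∀ z ∈ R, 0 < p z ∧ p z < 1) ∧ ∑ z ∈ R, p z = 1

/-- `V⁺ ∈ L¹`. -/
def VplusL1 (ℙ : Measure Ω) (V : Ω → Zd d → ℝ) (R : Finset (Zd d)) : Prop :=
  ∀ z ∈ R, Integrable (fun ω => max (V ω z) 0) ℙ

/-- Assumption (i): `V ≥ 0` a.s. on `R₀` and `V ≥ c` a.s. on `R ∖ R₀`. -/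
def AssumptionI (ℙ : Measure Ω) (V : Ω → Zd d → ℝ) (R : Finset (Zd d))
    (U₀ : Set (Fin d → ℝ)) : Prop :=
  (∀ z ∈ R0 R U₀, ∀ᵐ ω ∂ℙ, 0 ≤ V ω z) ∧
  ∃ c : ℝ, ∀ z ∈ R, toR z ∉ U₀ → ∀ᵐ ω ∂ℙ, c ≤ V ω z

end measurable

end RWRP

namespace RWRP

section lists

variable {d : ℕ} {R : Finset (Zd d)}

/-- weight of a list of steps -/
def LW (w : Zd d → Zd d → ℝ≥0∞) : Zd d → List {z : Zd d // z ∈ R} → ℝ≥0∞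
  | _, [] => 1
  | x, z :: l => w x z * LW w (x + z) l

/-- sum of a list of steps -/
def LS : List {z : Zd d // z ∈ R} → Zd d
  | [] => 0
  | z :: l => (z : Zd d) + LS l

/-- first hit -/
def FH (y : Zd d) : Zd d → List {z : Zd d // z ∈ R} → Prop
  | _, [] => False
  | x, z :: l => (l = [] ∧ x + z = y) ∨ (x + z ≠ y ∧ FH y (x + z) l)

theorem LS_append (a b : List {z : Zd d // z ∈ R}) : LS (a ++ b) = LS a + LS b := by
  induction a with
  | nil => simp [LS]
  | cons z a ih => simp [LS, ih, add_assoc]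

theorem LW_append (w : Zd d → Zd d → ℝ≥0∞) (a b : List {z : Zd d // z ∈ R}) (x : Zd d) :
    LW w x (a ++ b) = LW w x a * LW w (x + LS a) b := by
  induction a generalizing x with
  | nil => simp [LS, LW]
  | cons z a ih => simp [LS, LW, ih, add_assoc, mul_assoc]

theorem FH_sum {y x : Zd d} {l : List {z : Zd d // z ∈ R}} (h : FH y x l) : x + LS l = y := by
  induction l generalizing x with
  | nil => exact h.elim
  | cons z l ih =>
    rcases h with ⟨rfl, h⟩ | ⟨_, h⟩
    · simpa [LS] using h
    · have := ih h
      simpa [LS, add_assoc] using this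

theorem FH_ne {y x : Zd d} {l : List {z : Zd d // z ∈ R}} (h : FH y x l) : l ≠ [] := by
  rintro rfl; exact h

theorem FH_prefix {y x : Zd d} {a b a' b' : List {z : Zd d // z ∈ R}} (h : FH y x a)
    (h' : FH y x a') (e : a ++ b = a' ++ b') : a = a' := by
  induction a generalizing x a' with
  | nil => exact h.elim
  | cons z a ih =>
    cases a' with
    | nil => exact h'.elim
    | cons z' a' =>
      simp only [List.cons_append, List.cons.injEq] at e
      obtain ⟨rfl, e⟩ := e
      rcases h with ⟨rfl, h⟩ | ⟨h1, h⟩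
      · rcases h' with ⟨rfl, h'⟩ | ⟨h1', h'⟩
        · rfl
        · exact (h1' h).elim
      · rcases h' with ⟨rfl, h'⟩ | ⟨h1', h'⟩
        · exact (h1 h').elim
        · rw [ih h h' e]

theorem FH_exists {y x : Zd d} {l : List {z : Zd d // z ∈ R}} (hl : l ≠ []) (h : x + LS l = y) :
    ∃ a b, FH y x a ∧ l = a ++ b := by
  induction l generalizing x with
  | nil => exact (hl rfl).elim
  | cons z l ih =>
    by_cases hz : x + (z : Zd d) = y
    · exact ⟨[z], l, Or.inl ⟨rfl, hz⟩, rfl⟩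
    · have hl' : l ≠ [] := by
        rintro rfl
        simp [LS] at h
        exact hz h
      obtain ⟨a, b, ha, rfl⟩ := ih (x := x + z) hl' (by simpa [LS, add_assoc] using h)
      exact ⟨z :: a, b, Or.inr ⟨hz, ha⟩, rfl⟩

/-- Kernel over lists -/
def KL (R : Finset (Zd d)) (w : Zd d → Zd d → ℝ≥0∞) (x y : Zd d) : ℝ≥0∞ :=
  ∑' l : List {z : Zd d // z ∈ R}, if FH y x l then LW w x l else 0

/-- Green function over lists -/
def GRL (R : Finset (Zd d)) (w : Zd d → Zd d → ℝ≥0∞) (x y : Zd d) : ℝ≥0∞ :=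
  ∑' l : List {z : Zd d // z ∈ R}, if x + LS l = y then LW w x l else 0

theorem renewal (w : Zd d → Zd d → ℝ≥0∞) (x y : Zd d)
    (h : List {z : Zd d // z ∈ R} → ℝ≥0∞) :
    (∑' l : List {z : Zd d // z ∈ R}, if l ≠ [] ∧ x + LS l = y then LW w x l * h l else 0) =
      ∑' a : List {z : Zd d // z ∈ R}, ∑' b : List {z : Zd d // z ∈ R},
        (if FH y x a then LW w x a else 0) * ((if y + LS b = y then LW w y b else 0) * h (a ++ b)) := by
  rw [← ENNReal.tsum_prod]
  have key : ∀ q : List {z : Zd d // z ∈ R} × List {z : Zd d // z ∈ R},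
      ((if FH y x q.1 then LW w x q.1 else 0) *
        ((if y + LS q.2 = y then LW w y q.2 else 0) * h (q.1 ++ q.2))) ≠ 0 →
      FH y x q.1 ∧ y + LS q.2 = y := by
    intro q hq
    constructor
    · by_contra hc
      exact hq (by simp [hc])
    · by_contra hc
      exact hq (by rw [if_neg hc]; simp)
  refine tsum_eq_tsum_of_ne_zero_bij (fun q => q.1.1 ++ q.1.2) ?_ ?_ ?_
  · rintro ⟨⟨a, b⟩, hq⟩ ⟨⟨a', b'⟩, hq'⟩ e
    have h1 := key _ hq
    have h2 := key _ hq'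
    have e' : a ++ b = a' ++ b' := e
    have ha : a = a' := FH_prefix h1.1 h2.1 e'
    subst ha
    simp at e'
    subst e'
    rfl
  · intro l hl
    have hl' : l ≠ [] ∧ x + LS l = y := by
      by_contra hc
      exact hl (if_neg hc)
    obtain ⟨a, b, ha, rfl⟩ := FH_exists hl'.1 hl'.2
    have hs := FH_sum ha
    have hb : y + LS b = y := by
      have := hl'.2
      rw [LS_append, ← add_assoc, hs] at this
      exact this
    refine ⟨⟨(a, b), ?_⟩, rfl⟩
    rw [Function.mem_support] at hl ⊢
    rw [if_pos hl', LW_append, hs] at hl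
    simp only [if_pos ha, if_pos hb]
    rwa [← mul_assoc]
  · rintro ⟨⟨a, b⟩, hq⟩
    have h1 := key _ hq
    have hs := FH_sum h1.1
    have h2 : a ++ b ≠ [] ∧ x + LS (a ++ b) = y := by
      refine ⟨by simp [FH_ne h1.1], ?_⟩
      rw [LS_append, ← add_assoc, hs]; exact h1.2
    simp only [if_pos h1.1, if_pos h1.2, if_pos h2]
    rw [LW_append, hs, mul_assoc]

theorem tsum_list (F : List {z : Zd d // z ∈ R} → ℝ≥0∞) :
    ∑' l, F l = ∑' n : ℕ, ∑ s : Fin n → {z : Zd d // z ∈ R}, F (List.ofFn s) := by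
  rw [← (List.equivSigmaTuple).symm.tsum_eq, ENNReal.tsum_sigma']
  simp [tsum_fintype, List.equivSigmaTuple]

theorem tsum_list_cons (F : List {z : Zd d // z ∈ R} → ℝ≥0∞) :
    ∑' l, F l = F [] + ∑ z : {z : Zd d // z ∈ R}, ∑' l, F (z :: l) := by
  rw [tsum_list, tsum_eq_zero_add' ENNReal.summable]
  congr 1
  · simp
  · simp_rw [tsum_list (fun l => F (_ :: l))]
    rw [← Summable.tsum_finsetSum (fun _ _ => ENNReal.summable)]
    congr 1; ext n
    rw [← (Fin.consEquiv (fun _ => {z : Zd d // z ∈ R})).sum_comp, Fintype.sum_prod_type]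
    simp [Fin.consEquiv, List.ofFn_succ]

theorem green_eq (w : Zd d → Zd d → ℝ≥0∞) (x y : Zd d) (hxy : y ≠ x) :
    GRL R w x y = KL R w x y * GRL R w y y := by
  have := renewal (R := R) w x y (fun _ => 1)
  simp only [mul_one, ENNReal.tsum_mul_left, ENNReal.tsum_mul_right] at this
  rw [GRL, KL, GRL, ← this]
  congr 1; ext l
  by_cases hl : l = []
  · subst hl
    simp [LS, hxy.symm]
  · simp [hl]

/-- truncated Green function -/
def GRN (R : Finset (Zd d)) (w : Zd d → Zd d → ℝ≥0∞) (N : ℕ) (x : Zd d) : ℝ≥0∞ :=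
  ∑' l : List {z : Zd d // z ∈ R},
    (if x + LS l = x then LW w x l else 0) * (if l.length ≤ N then 1 else 0)

theorem LW_ne_top (w : Zd d → Zd d → ℝ≥0∞) (hw : ∀ x z, w x z ≠ ⊤) (x : Zd d)
    (l : List {z : Zd d // z ∈ R}) : LW w x l ≠ ⊤ := by
  induction l generalizing x with
  | nil => simp [LW]
  | cons z l ih => exact ENNReal.mul_ne_top (hw _ _) (ih _)

theorem GRN_ne_top (w : Zd d → Zd d → ℝ≥0∞) (hw : ∀ x z, w x z ≠ ⊤) (N : ℕ) (x : Zd d) :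
    GRN R w N x ≠ ⊤ := by
  have hf : {l : List {z : Zd d // z ∈ R} | l.length ≤ N}.Finite := List.finite_length_le _ N
  rw [GRN, tsum_eq_sum (s := hf.toFinset)]
  · refine ENNReal.sum_ne_top.2 fun l _ => ENNReal.mul_ne_top ?_ ?_
    · split_ifs
      · exact LW_ne_top w hw x l
      · simp
    · split_ifs <;> simp
  · intro l hl
    have : ¬ l.length ≤ N := by simpa using hl
    simp [this]

theorem GRN_le (w : Zd d → Zd d → ℝ≥0∞) (N : ℕ) (x : Zd d) :
    GRN R w N x ≤ 1 + KL R w x x * GRN R w N x := by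
  have h := renewal (R := R) w x x (fun l => if l.length ≤ N then 1 else 0)
  have h1 : GRN R w N x ≤ (∑' l : List {z : Zd d // z ∈ R}, if l = [] then 1 else 0) +
      (∑' l : List {z : Zd d // z ∈ R}, if l ≠ [] ∧ x + LS l = x then
        LW w x l * (if l.length ≤ N then 1 else 0) else 0) := by
    rw [← ENNReal.tsum_add]
    refine ENNReal.tsum_le_tsum fun l => ?_
    by_cases hl : l = []
    · subst hl; simp [LS, LW]
    · simp only [hl, if_false, ne_eq, not_false_eq_true, true_and, zero_add]
      split_ifs <;> simp
  refine h1.trans (add_le_add ?_ ?_)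
  · simp
  · rw [h, KL, GRN, ← ENNReal.tsum_mul_right]
    refine ENNReal.tsum_le_tsum fun a => ?_
    rw [← ENNReal.tsum_mul_left]
    refine ENNReal.tsum_le_tsum fun b => ?_
    gcongr
    split_ifs with h1 h2 <;> simp_all
    omega

theorem GRL_bound (w : Zd d → Zd d → ℝ≥0∞) (hw : ∀ x z, w x z ≠ ⊤) (x : Zd d) (q : ℝ≥0∞)
    (hq : KL R w x x + q ≤ 1) : q * GRL R w x x ≤ 1 := by
  have hN : ∀ N, q * GRN R w N x ≤ 1 := by
    intro N
    have h1 := GRN_le (R := R) w N x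
    have ht := GRN_ne_top (R := R) w hw N x
    have hK : KL R w x x ≠ ⊤ := ne_top_of_le_ne_top ENNReal.one_ne_top (le_self_add.trans hq)
    have hKt : KL R w x x * GRN R w N x ≠ ⊤ := ENNReal.mul_ne_top hK ht
    have h2 : KL R w x x * GRN R w N x + q * GRN R w N x ≤ KL R w x x * GRN R w N x + 1 := by
      rw [← add_mul]
      calc (KL R w x x + q) * GRN R w N x ≤ 1 * GRN R w N x := by gcongr
        _ = GRN R w N x := one_mul _
        _ ≤ _ := by rw [add_comm]; exact h1
    exact (ENNReal.add_le_add_iff_left hKt).1 h2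
  rw [GRL, ← ENNReal.tsum_mul_left, ENNReal.tsum_eq_iSup_sum]
  refine iSup_le fun s => ?_
  refine le_trans ?_ (hN (s.sup List.length))
  rw [GRN, ← ENNReal.tsum_mul_left]
  refine le_trans ?_ (ENNReal.sum_le_tsum s)
  refine Finset.sum_le_sum fun l hl => ?_
  have : l.length ≤ s.sup List.length := Finset.le_sup (f := List.length) hl
  simp [this]

theorem kraftN (p : Zd d → ℝ≥0∞) (hp : ∑ z ∈ R, p z ≤ 1) (y : Zd d) (N : ℕ) (x : Zd d) :
    (∑' l : List {z : Zd d // z ∈ R},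
      if FH y x l ∧ l.length ≤ N then LW (fun _ z => p z) x l else 0) ≤ 1 := by
  induction N generalizing x with
  | zero =>
    have : ∀ l : List {z : Zd d // z ∈ R}, ¬ (FH y x l ∧ l.length ≤ 0) := by
      rintro l ⟨h1, h2⟩
      exact FH_ne h1 (List.eq_nil_of_length_eq_zero (by omega))
    simp only [if_neg (this _)]
    simp
  | succ N ih =>
    rw [tsum_list_cons]
    have h0 : ¬ FH y x ([] : List {z : Zd d // z ∈ R}) := fun h => h
    simp only [h0, false_and, if_false, zero_add]
    calc _ ≤ ∑ z : {z : Zd d // z ∈ R}, p z := ?_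
      _ = ∑ z ∈ R, p z := (Finset.sum_coe_sort R p)
      _ ≤ 1 := hp
    refine Finset.sum_le_sum fun z _ => ?_
    by_cases hz : x + (z : Zd d) = y
    · have : ∀ l : List {z : Zd d // z ∈ R},
        (if FH y x (z :: l) ∧ (z :: l).length ≤ N + 1 then LW (fun _ z => p z) x (z :: l) else 0)
          ≤ if l = [] then p z else 0 := by
        intro l
        by_cases hl : l = []
        · subst hl; rw [if_pos rfl]; split_ifs <;> simp [LW]
        · simp [FH, hl, hz]
      refine (ENNReal.tsum_le_tsum this).trans ?_
      simp
    · have : ∀ l : List {z : Zd d // z ∈ R},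
        (if FH y x (z :: l) ∧ (z :: l).length ≤ N + 1 then LW (fun _ z => p z) x (z :: l) else 0)
          ≤ p z * (if FH y (x + z) l ∧ l.length ≤ N then LW (fun _ z => p z) (x + z) l else 0) := by
        intro l
        simp [FH, hz, LW]
      refine (ENNReal.tsum_le_tsum this).trans ?_
      rw [ENNReal.tsum_mul_left]
      calc _ ≤ p z * 1 := by gcongr; exact ih _
        _ = _ := mul_one _

theorem kraft (p : Zd d → ℝ≥0∞) (hp : ∑ z ∈ R, p z ≤ 1) (x y : Zd d) :
    KL R (fun _ z => p z) x y ≤ 1 := by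
  rw [KL, ENNReal.tsum_eq_iSup_sum]
  refine iSup_le fun s => ?_
  refine le_trans ?_ (kraftN p hp y (s.sup List.length) x)
  refine le_trans ?_ (ENNReal.sum_le_tsum s)
  refine Finset.sum_le_sum fun l hl => ?_
  have : l.length ≤ s.sup List.length := Finset.le_sup (f := List.length) hl
  simp [this]

theorem LW_le (w w' : Zd d → Zd d → ℝ≥0∞) (S : Set (Zd d))
    (h : ∀ x, ∀ z ∈ S, w x z ≤ w' x z) (l : List {z : Zd d // z ∈ R})
    (hl : ∀ z ∈ l, (z : Zd d) ∈ S) (x : Zd d) : LW w x l ≤ LW w' x l := by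
  induction l generalizing x with
  | nil => simp [LW]
  | cons z l ih =>
    simp only [LW]
    exact mul_le_mul' (h _ _ (hl z (by simp))) (ih (fun z hz => hl z (by simp [hz])) _)

theorem LW_shift (p : Zd d → ℝ≥0∞) (l : List {z : Zd d // z ∈ R}) (x y : Zd d) :
    LW (fun _ z => p z) x l = LW (fun _ z => p z) y l := by
  induction l generalizing x y with
  | nil => simp [LW]
  | cons z l ih => simp only [LW]; rw [ih]

theorem LW_ge_pow (p : Zd d → ℝ≥0∞) (m : ℝ≥0∞) (hm : ∀ z ∈ R, m ≤ p z)
    (l : List {z : Zd d // z ∈ R}) (x : Zd d) :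
    m ^ l.length ≤ LW (fun _ z => p z) x l := by
  induction l generalizing x with
  | nil => simp [LW]
  | cons z l ih =>
    simp only [LW, List.length_cons]
    rw [pow_succ']
    exact mul_le_mul' (hm _ z.2) (ih _)

theorem FH_edge (x y : Zd d) (z : {z : Zd d // z ∈ R}) (n : ℕ) :
    ∀ a b : List {z : Zd d // z ∈ R}, a.length ≤ n → x + LS a = y → LS (a ++ z :: b) = 0 →
    ∃ a' b', FH x x (a' ++ z :: b') ∧ x + LS a' = y ∧
      (a' ++ z :: b').length ≤ (a ++ z :: b).length := by
  induction n with
  | zero =>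
    intro a b ha hy h0
    have : a = [] := List.eq_nil_of_length_eq_zero (by omega)
    subst this
    obtain ⟨l1, l2, h1, h2⟩ := FH_exists (x := x) (y := x) (l := z :: b) (by simp) (by
      simp only [List.nil_append] at h0; simp [h0])
    cases l1 with
    | nil => exact h1.elim
    | cons z' l1 =>
      simp at h2
      obtain ⟨rfl, rfl⟩ := h2
      exact ⟨[], l1, h1, hy, by simp⟩
  | succ n ih =>
    intro a b ha hy h0
    obtain ⟨l1, l2, h1, h2⟩ := FH_exists (x := x) (y := x) (l := a ++ z :: b) (by simp) (by
      simp [h0])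
    have hs1 : LS l1 = 0 := by simpa using FH_sum h1
    rcases List.append_eq_append_iff.1 h2 with ⟨c, hc1, hc2⟩ | ⟨c, hc1, hc2⟩
    · cases c with
      | nil =>
        simp at hc1 hc2
        subst hc1
        have : x + LS ([] : List {z : Zd d // z ∈ R}) = y := by simpa [LS, hs1] using hy
        rw [LS_append, hs1, zero_add] at h0
        obtain ⟨a', b', q1, q2, q3⟩ := ih [] b (by simp) this (by simpa using h0)
        exact ⟨a', b', q1, q2, q3.trans (by simp)⟩
      | cons z' c =>
        simp at hc2
        obtain ⟨rfl, rfl⟩ := hc2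
        subst hc1
        exact ⟨a, c, h1, hy, by simp⟩
    · subst hc1
      have hl1 : 0 < l1.length := List.length_pos_of_ne_nil (FH_ne h1)
      simp only [List.length_append] at ha
      have e1 : x + LS c = y := by rw [LS_append, hs1, zero_add] at hy; exact hy
      have e2 : LS (c ++ z :: b) = 0 := by
        rw [List.append_assoc, LS_append, hs1, zero_add] at h0; exact h0
      obtain ⟨a', b', q1, q2, q3⟩ := ih c b (by omega) e1 e2
      refine ⟨a', b', q1, q2, q3.trans ?_⟩
      simp

theorem KL_add_le (w : Zd d → Zd d → ℝ≥0∞) (p : Zd d → ℝ≥0∞) (hp : ∑ z ∈ R, p z ≤ 1)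
    (S : Set (Zd d)) (h : ∀ x, ∀ z ∈ S, w x z ≤ p z) (x : Zd d)
    (hS : ∀ l : List {z : Zd d // z ∈ R}, LS l = 0 → ∀ z ∈ l, (z : Zd d) ∈ S)
    (m c : ℝ≥0∞) (hm : ∀ z ∈ R, m ≤ p z) (hm1 : m ≤ 1) (hc : c ≤ 1)
    (z : {z : Zd d // z ∈ R}) (a b : List {z : Zd d // z ∈ R})
    (hz : w (x + LS a) z ≤ c * p z) (h0 : LS (a ++ z :: b) = 0) (L : ℕ)
    (hL : (a ++ z :: b).length ≤ L) :
    KL R w x x + m ^ L * (1 - c) ≤ 1 := by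
  obtain ⟨a', b', q1, q2, q3⟩ := FH_edge x _ z _ a b le_rfl rfl h0
  refine le_trans ?_ (kraft (R := R) p hp x x)
  have hmL : m ^ L ≤ LW (fun _ z => p z) x (a' ++ z :: b') :=
    (pow_le_pow_right_of_le_one' hm1 (q3.trans hL)).trans (LW_ge_pow p m hm _ x)
  set l0 := a' ++ z :: b' with hl0
  have hsum : LS l0 = 0 := by simpa using FH_sum q1
  have hl0S := hS l0 hsum
  have hw0 : LW w x l0 ≤ c * LW (fun _ z => p z) x l0 := by
    rw [hl0, LW_append, LW_append, LW, LW, q2]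
    have e1 := LW_le w (fun _ z => p z) S h a' (fun z hz => hl0S z (by simp [hl0, hz])) x
    have e2 := LW_le w (fun _ z => p z) S h b' (fun z hz => hl0S z (by simp [hl0, hz]))
      (x + LS a + z)
    calc _ ≤ LW (fun _ z => p z) x a' *
          ((c * p z) * LW (fun _ z => p z) (x + LS a + z) b') := by gcongr
      _ = _ := by ring
  calc KL R w x x + m ^ L * (1 - c)
      ≤ KL R w x x + LW (fun _ z => p z) x l0 * (1 - c) := by gcongr
    _ = ∑' l : List {z : Zd d // z ∈ R}, ((if FH x x l then LW w x l else 0) +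
          if l = l0 then LW (fun _ z => p z) x l0 * (1 - c) else 0) := by
        rw [ENNReal.tsum_add, KL]; simp
    _ ≤ KL R (fun _ z => p z) x x := by
        rw [KL]
        refine ENNReal.tsum_le_tsum fun l => ?_
        by_cases hl : l = l0
        · subst hl
          simp only [q1, if_true]
          calc _ ≤ c * LW (fun _ z => p z) x l0 + LW (fun _ z => p z) x l0 * (1 - c) := by gcongr
            _ = LW (fun _ z => p z) x l0 * (c + (1 - c)) := by ring
            _ = _ := by rw [add_tsub_cancel_of_le hc, mul_one]
        · simp only [hl, if_false, add_zero]
          split_ifs with hF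
          · exact LW_le w (fun _ z => p z) S h l (hS l (by simpa using FH_sum hF)) x
          · exact le_rfl

theorem KL_le_KL (w : Zd d → Zd d → ℝ≥0∞) (p : Zd d → ℝ≥0∞)
    (S : Set (Zd d)) (h : ∀ x, ∀ z ∈ S, w x z ≤ p z) (x : Zd d)
    (hS : ∀ l : List {z : Zd d // z ∈ R}, LS l = 0 → ∀ z ∈ l, (z : Zd d) ∈ S) :
    KL R w x x ≤ KL R (fun _ z => p z) 0 0 := by
  refine ENNReal.tsum_le_tsum fun l => ?_
  have key : ∀ (l : List {z : Zd d // z ∈ R}) (u v t : Zd d), FH u v l ↔ FH (u + t) (v + t) l := by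
    intro l
    induction l with
    | nil => intros; rfl
    | cons z l ih =>
      intro u v t
      simp only [FH]
      rw [ih u (v + z) t, show v + t + (z : Zd d) = v + z + t by abel]
      simp
  have k := key l 0 0 x
  simp only [zero_add] at k
  by_cases hF : FH x x l
  · rw [if_pos hF, if_pos (k.2 hF), LW_shift p l 0 x]
    exact LW_le w (fun _ z => p z) S h l (hS l (by simpa using FH_sum hF)) x
  · simp [hF]

theorem pos_succ (x : Zd d) (f : ℕ → Zd d) (k : ℕ) :
    pos x f (k + 1) = pos (x + f 0) (fun i => f (i + 1)) k := by
  simp only [pos]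
  rw [Finset.sum_range_succ']
  abel

theorem stepF_tail (n : ℕ) (s : Fin (n + 1) → {z : Zd d // z ∈ R}) :
    (fun i => stepF (n + 1) s (i + 1)) = stepF n (fun i => s i.succ) := by
  ext i : 1
  simp [stepF, Fin.succ]

theorem stepF_zero (n : ℕ) (s : Fin (n + 1) → {z : Zd d // z ∈ R}) :
    stepF (n + 1) s 0 = s 0 := by
  simp [stepF]

theorem pos_eq (n : ℕ) (s : Fin n → {z : Zd d // z ∈ R}) (x : Zd d) :
    pos x (stepF n s) n = x + LS (List.ofFn s) := by
  induction n generalizing x with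
  | zero => simp [pos, LS]
  | succ n ih =>
    rw [pos_succ, stepF_tail, stepF_zero, ih, List.ofFn_succ, LS, add_assoc]

theorem firstHit_iff (n : ℕ) (s : Fin (n + 1) → {z : Zd d // z ∈ R}) (x y : Zd d) :
    firstHit x y (n + 1) (stepF (n + 1) s) ↔ FH y x (List.ofFn s) := by
  induction n generalizing x with
  | zero =>
    simp [firstHit, FH, pos_eq, LS]
    intro _ k h1 h2
    omega
  | succ n ih =>
    rw [List.ofFn_succ, FH, ← ih]
    have h1 : ¬ (List.ofFn (fun i => s (Fin.succ i)) = []) := by simp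
    simp only [h1, false_and, false_or]
    rw [← stepF_tail, firstHit, firstHit, pos_succ, stepF_zero]
    constructor
    · rintro ⟨h2, h3⟩
      refine ⟨?_, h2, ?_⟩
      · have := h3 1 (by simp)
        rw [pos_succ, stepF_zero] at this
        simpa [pos] using this
      · intro k hk
        have := h3 (k + 1) (by simp at hk ⊢; omega)
        rwa [pos_succ, stepF_zero] at this
    · rintro ⟨h0, h2, h3⟩
      refine ⟨h2, ?_⟩
      intro k hk
      cases k with
      | zero => simp at hk
      | succ k =>
        rw [pos_succ, stepF_zero]
        by_cases hk0 : k = 0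
        · subst hk0; simpa [pos] using h0
        · exact h3 k (by simp at hk ⊢; omega)

theorem LW_ofFn_p (p : Zd d → ℝ) (n : ℕ) (s : Fin n → {z : Zd d // z ∈ R}) (x : Zd d) :
    pathW p s = LW (fun _ z => ENNReal.ofReal (p z)) x (List.ofFn s) := by
  induction n generalizing x with
  | zero => simp [pathW, LW]
  | succ n ih =>
    rw [List.ofFn_succ, LW, ← ih, pathW, Fin.prod_univ_succ, pathW]

/-- the walk weight -/
def wgt {Ω : Type*} (T : Zd d → Ω → Ω) (V : Ω → Zd d → ℝ) (p : Zd d → ℝ) (ω : Ω) :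
    Zd d → Zd d → ℝ≥0∞ :=
  fun x z => ENNReal.ofReal (p z) * ENNReal.ofReal (Real.exp (-(V (T x ω) z)))

theorem LW_ofFn {Ω : Type*} (T : Zd d → Ω → Ω) (V : Ω → Zd d → ℝ) (ω : Ω) (p : Zd d → ℝ) (n : ℕ)
    (s : Fin n → {z : Zd d // z ∈ R}) (x : Zd d) :
    pathW p s * ENNReal.ofReal (Real.exp (-(pathV T V ω x n (stepF n s)))) =
      LW (wgt T V p ω) x (List.ofFn s) := by
  induction n generalizing x with
  | zero => simp [pathW, LW, pathV]
  | succ n ih =>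
    rw [List.ofFn_succ, LW, ← ih, pathW, Fin.prod_univ_succ, pathW, pathV, Finset.sum_range_succ',
      neg_add, Real.exp_add, ENNReal.ofReal_mul (by positivity), pathV, wgt]
    simp only [pos_succ, stepF_zero]
    rw [← stepF_tail]
    simp only [pos, Finset.range_zero, Finset.sum_empty, add_zero]
    ring

theorem walkK_eq {Ω : Type*} (T : Zd d → Ω → Ω) (V : Ω → Zd d → ℝ) (p : Zd d → ℝ) (ω : Ω)
    (x y : Zd d) : walkK T V p R ω x y = KL R (wgt T V p ω) x y := by
  rw [KL, tsum_list, tsum_eq_zero_add' ENNReal.summable, walkK]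
  simp only [firstHit_iff, LW_ofFn]
  simp [FH]

theorem retP_eq (p : Zd d → ℝ) :
    retP p R = KL R (fun _ z => ENNReal.ofReal (p z)) 0 0 := by
  rw [KL, tsum_list, tsum_eq_zero_add' ENNReal.summable, retP]
  simp only [firstHit_iff, LW_ofFn_p p _ _ 0]
  simp [FH]

theorem greenK_eq {Ω : Type*} (T : Zd d → Ω → Ω) (V : Ω → Zd d → ℝ) (p : Zd d → ℝ) (ω : Ω)
    (x y : Zd d) : greenK T V p R ω x y = GRL R (wgt T V p ω) x y := by
  rw [GRL, tsum_list, tsum_eq_zero_add' ENNReal.summable, greenK]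
  simp only [pos_eq, LW_ofFn]
  congr 1
  simp [LS, LW, eq_comm]

end lists
end RWRP

namespace RWRP

section geom

variable {d : ℕ} {R : Finset (Zd d)}

theorem toR_add (x y : Zd d) : toR (x + y) = toR x + toR y := by
  ext i; simp [toR]
theorem toR_zero : toR (0 : Zd d) = 0 := by
  ext i; simp [toR]
theorem toR_neg (x : Zd d) : toR (-x) = - toR x := by
  ext i; simp [toR]
theorem toR_sub (x y : Zd d) : toR (x - y) = toR x - toR y := by
  ext i; simp [toR]
theorem toR_nsmul (n : ℕ) (x : Zd d) : toR (n • x) = (n : ℝ) • toR x := by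
  ext i; simp [toR]
theorem toR_zsmul (n : ℤ) (x : Zd d) : toR (n • x) = (n : ℝ) • toR x := by
  ext i; simp [toR]
theorem toR_sum {ι : Type*} (s : Finset ι) (f : ι → Zd d) :
    toR (∑ i ∈ s, f i) = ∑ i ∈ s, toR (f i) := by
  ext i; simp [toR]
theorem toR_inj {x y : Zd d} (h : toR x = toR y) : x = y := by
  ext i
  have := congrFun h i
  simpa [toR] using this

theorem avg_mem (l : List {z : Zd d // z ∈ R}) (hl : l ≠ []) :
    ((l.length : ℝ))⁻¹ • toR (LS l) ∈ hullU R := by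
  induction l with
  | nil => exact (hl rfl).elim
  | cons z l ih =>
    have hz : toR (z : Zd d) ∈ hullU R := subset_convexHull _ _ ⟨z, z.2, rfl⟩
    by_cases h0 : l = []
    · subst h0; simpa [LS] using hz
    · have hn : (0 : ℝ) < l.length := by exact_mod_cast List.length_pos_of_ne_nil h0
      have := (convex_convexHull ℝ (toR '' (R : Set (Zd d)))) hz (ih h0)
        (a := ((l.length : ℝ) + 1)⁻¹) (b := (l.length : ℝ) * ((l.length : ℝ) + 1)⁻¹)
        (by positivity) (by positivity) (by field_simp; ring)
      convert this using 1
      · rfl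
      rw [LS, toR_add, List.length_cons, smul_add, smul_smul]
      have e : (((l.length + 1 : ℕ) : ℝ))⁻¹ = ((l.length : ℝ) + 1)⁻¹ := by push_cast; rfl
      rw [e]
      congr 2
      field_simp

theorem loop_R0 {U₀ : Set (Fin d → ℝ)} (hU₀ : IsZeroFace R U₀) (l : List {z : Zd d // z ∈ R})
    (h : LS l = 0) : ∀ z ∈ l, (z : Zd d) ∈ R0 R U₀ := by
  intro z hz
  refine ⟨z.2, ?_⟩
  have hne : l ≠ [] := List.ne_nil_of_mem hz
  have hm := avg_mem l hne
  rw [h, toR_zero, smul_zero] at hm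
  rcases hU₀ with ⟨h0, hF, hI⟩ | ⟨h0, _⟩
  · have hz0 : (0 : Fin d → ℝ) ∈ U₀ := intrinsicInterior_subset hI
    obtain ⟨a, b, rfl⟩ := List.append_of_mem hz
    have hs : (z : Zd d) + LS (a ++ b) = 0 := by
      rw [← h, LS_append, LS_append, LS]; abel
    by_cases hr : a ++ b = []
    · rw [hr] at hs
      have : (z : Zd d) = 0 := by simpa [LS] using hs
      rw [this, toR_zero]; exact hz0
    · have hn : (0 : ℝ) < (a ++ b).length := by exact_mod_cast List.length_pos_of_ne_nil hr
      have hη := avg_mem (a ++ b) hr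
      set n : ℝ := ((a ++ b).length : ℝ)
      have hs' : toR (z : Zd d) + toR (LS (a ++ b)) = 0 := by rw [← toR_add, hs, toR_zero]
      refine (hF.2.2 hz0 (subset_convexHull _ _ ⟨z, z.2, rfl⟩) hη (t := (n + 1)⁻¹) ?_ ?_).1
      · exact ⟨by positivity, inv_lt_one_of_one_lt₀ (by linarith)⟩
      · have : (1 - (n + 1)⁻¹) * n⁻¹ = (n + 1)⁻¹ := by field_simp; ring
        rw [smul_smul, this, ← smul_add, hs', smul_zero]
  · exact (h0 hm).elim

theorem mem_relint {s : Set (Fin d → ℝ)} {x : Fin d → ℝ} :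
    x ∈ intrinsicInterior ℝ s ↔ x ∈ affineSpan ℝ s ∧
      ∃ r > 0, ∀ y ∈ affineSpan ℝ s, dist y x < r → y ∈ s := by
  rw [mem_intrinsicInterior]
  constructor
  · rintro ⟨y, hy, rfl⟩
    refine ⟨y.2, ?_⟩
    rw [mem_interior_iff_mem_nhds, Metric.mem_nhds_iff] at hy
    obtain ⟨r, hr, h⟩ := hy
    exact ⟨r, hr, fun u hu hd => h (show (⟨u, hu⟩ : affineSpan ℝ s) ∈ Metric.ball y r from hd)⟩
  · rintro ⟨hx, r, hr, h⟩
    refine ⟨⟨x, hx⟩, ?_, rfl⟩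
    rw [mem_interior_iff_mem_nhds, Metric.mem_nhds_iff]
    exact ⟨r, hr, fun u hu => h u u.2 hu⟩

theorem dirichlet (b : Zd d → ℝ) (hb : ∀ z, 0 ≤ b z) (h0 : ∑ z ∈ R, b z • toR z = 0) :
    ∃ m : Zd d → ℕ, ∑ z ∈ R, m z • z = 0 ∧ ∀ z ∈ R, 0 < b z → 0 < m z := by
  set B : ℝ := ∑ z ∈ R, ∑ i, |(z i : ℝ)| with hB
  have hB0 : 0 ≤ B := by positivity
  let u : ℕ → (R → ℝ) := fun N w => Int.fract (N * b w)
  have hu : ∀ N, u N ∈ Set.Icc (0 : R → ℝ) 1 := fun N =>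
    ⟨fun w => Int.fract_nonneg _, fun w => (Int.fract_lt_one _).le⟩
  obtain ⟨a, _, φ, hφ, hlim⟩ := isCompact_Icc.tendsto_subseq hu
  have hc := hlim.cauchySeq
  obtain ⟨K, hK⟩ := Metric.cauchySeq_iff'.1 hc (1 / (1 + B)) (by positivity)
  obtain ⟨J, hJ⟩ : ∃ J : ℕ, ∀ z ∈ R, 0 < b z → 2 ≤ J * b z := by
    have : ∀ z : Zd d, ∃ J : ℕ, 0 < b z → 2 ≤ J * b z := by
      intro z
      obtain ⟨J, hJ⟩ := exists_nat_ge (2 / b z)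
      exact ⟨J, fun hz => by rwa [div_le_iff₀ hz] at hJ⟩
    choose J hJ using this
    refine ⟨R.sup J, fun z hz hbz => (hJ z hbz).trans ?_⟩
    have : J z ≤ R.sup J := Finset.le_sup hz
    gcongr
  have hfar : φ K + J ≤ φ (K + J) := by
    have : ∀ J, φ K + J ≤ φ (K + J) := by
      intro J
      induction J with
      | zero => simp
      | succ J ih => have := hφ (show K + J < K + (J + 1) by omega); omega
    exact this J
  have hd := hK (K + J) (by omega)
  set i := φ K
  set j := φ (K + J)
  have hij : i ≤ j := by omega
  have hd' : ∀ z ∈ R, |Int.fract (j * b z) - Int.fract (i * b z)| ≤ 1 / (1 + B) := by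
    intro z hz
    exact (dist_le_pi_dist (u j) (u i) ⟨z, hz⟩).trans hd.le
  have hmono : ∀ z, ⌊(i : ℝ) * b z⌋ ≤ ⌊(j : ℝ) * b z⌋ := by
    intro z
    apply Int.floor_le_floor
    have := hb z
    gcongr
  refine ⟨fun z => (⌊(j : ℝ) * b z⌋ - ⌊(i : ℝ) * b z⌋).toNat, ?_, ?_⟩
  · have hcast : ∀ z, (((⌊(j : ℝ) * b z⌋ - ⌊(i : ℝ) * b z⌋).toNat : ℕ) : ℤ) =
        ⌊(j : ℝ) * b z⌋ - ⌊(i : ℝ) * b z⌋ := fun z => Int.toNat_of_nonneg (by linarith [hmono z])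
    ext k
    set s := (∑ z ∈ R, (⌊(j : ℝ) * b z⌋ - ⌊(i : ℝ) * b z⌋).toNat • z) k with hs
    have e1 : (s : ℝ) = ∑ z ∈ R, ((j - i : ℝ) * b z - (Int.fract (j * b z) - Int.fract (i * b z)))
        * (z k : ℝ) := by
      rw [hs]
      rw [Finset.sum_apply, Int.cast_sum]
      refine Finset.sum_congr rfl fun z _ => ?_
      have h := hcast z
      have h' : (((⌊(j : ℝ) * b z⌋ - ⌊(i : ℝ) * b z⌋).toNat : ℕ) : ℝ) =
        (⌊(j : ℝ) * b z⌋ : ℝ) - ⌊(i : ℝ) * b z⌋ := by exact_mod_cast h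
      rw [Pi.smul_apply, nsmul_eq_mul, Int.cast_mul, Int.cast_natCast, h', Int.fract, Int.fract]
      ring
    have e2 : ∑ z ∈ R, b z * (z k : ℝ) = 0 := by
      have := congrFun h0 k
      simpa [toR] using this
    have e3 : (s : ℝ) = - ∑ z ∈ R, (Int.fract (j * b z) - Int.fract (i * b z)) * (z k : ℝ) := by
      rw [e1]
      simp only [sub_mul _ _ ((_ : ℤ) : ℝ), Finset.sum_sub_distrib, mul_assoc]
      simp only [← Finset.mul_sum, e2]
      simp
    have e4 : |(s : ℝ)| < 1 := by
      rw [e3, abs_neg]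
      calc _ ≤ ∑ z ∈ R, |(Int.fract (j * b z) - Int.fract (i * b z)) * (z k : ℝ)| :=
            Finset.abs_sum_le_sum_abs _ _
        _ ≤ ∑ z ∈ R, 1 / (1 + B) * ∑ i, |(z i : ℝ)| := by
            refine Finset.sum_le_sum fun z hz => ?_
            rw [abs_mul]
            have h1 : |(z k : ℝ)| ≤ ∑ i, |(z i : ℝ)| :=
              Finset.single_le_sum (f := fun i => |(z i : ℝ)|) (fun _ _ => abs_nonneg _)
                (Finset.mem_univ k)
            exact mul_le_mul (hd' z hz) h1 (abs_nonneg _) (by positivity)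
        _ = B / (1 + B) := by rw [← Finset.mul_sum]; ring
        _ < 1 := by rw [div_lt_one (by positivity)]; linarith
    have e5 : |s| < 1 := by exact_mod_cast e4
    have : s = 0 := Int.abs_lt_one_iff.1 e5
    simpa using this
  · intro z hz hbz
    have h2 := hJ z hz hbz
    have h3 : (J : ℝ) ≤ j - i := by
      have : ((i + J : ℕ) : ℝ) ≤ j := by exact_mod_cast hfar
      push_cast at this; linarith
    have h4 : (J : ℝ) * b z ≤ (j - i) * b z := by gcongr
    have h5 : (0 : ℝ) < (⌊(j : ℝ) * b z⌋ : ℝ) - ⌊(i : ℝ) * b z⌋ := by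
      have := Int.lt_floor_add_one ((j : ℝ) * b z)
      have := Int.floor_le ((i : ℝ) * b z)
      nlinarith
    have h6 : 0 < ⌊(j : ℝ) * b z⌋ - ⌊(i : ℝ) * b z⌋ := by exact_mod_cast h5
    simpa using h6

theorem list_of_nat (S : Finset (Zd d)) (hS : S ⊆ R) (m : Zd d → ℕ) :
    ∃ l : List {z : Zd d // z ∈ R}, LS l = ∑ z ∈ S, m z • z := by
  induction S using Finset.induction_on with
  | empty => exact ⟨[], by simp [LS]⟩
  | insert z S hz ih =>
    obtain ⟨l, hl⟩ := ih (fun x hx => hS (by simp [hx]))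
    rw [Finset.sum_insert hz]
    have : ∀ k : ℕ, ∃ l : List {z : Zd d // z ∈ R}, LS l = k • z := by
      intro k
      induction k with
      | zero => exact ⟨[], by simp [LS]⟩
      | succ k ih =>
        obtain ⟨l, hl⟩ := ih
        exact ⟨⟨z, hS (by simp)⟩ :: l, by rw [LS, hl, succ_nsmul]; simp [add_comm]⟩
    obtain ⟨l', hl'⟩ := this (m z)
    exact ⟨l' ++ l, by rw [LS_append, hl, hl']⟩

theorem Cp_convex : Convex ℝ (Cp R) := by
  rintro _ ⟨b, hb, rfl⟩ _ ⟨c, hc, rfl⟩ s t hs ht _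
  refine ⟨fun z => s * b z + t * c z, fun z => ?_, ?_⟩
  · have := hb z; have := hc z; positivity
  · simp [Finset.smul_sum, add_smul, mul_smul, Finset.sum_add_distrib]

theorem mem_Cp {z : Zd d} (hz : z ∈ R) : toR z ∈ Cp R := by
  refine ⟨fun w => if w = z then 1 else 0, fun w => by dsimp only; split_ifs <;> simp, ?_⟩
  simp [ite_smul, hz]

theorem neg_exists {U₀ : Set (Fin d → ℝ)} (hU₀ : IsZeroFace R U₀) (z : Zd d) (hz : z ∈ R0 R U₀) :
    ∃ l : List {z : Zd d // z ∈ R}, LS l = - z := by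
  rcases hU₀ with ⟨h0, hF, hI⟩ | ⟨h0, h⟩
  swap
  · have := hz.2; rw [h] at this; exact this.elim
  rw [mem_relint] at hI
  obtain ⟨hI0, r, hr, hI⟩ := hI
  obtain ⟨t, ht, htr⟩ : ∃ t > 0, t * ‖toR z‖ < r := by
    refine ⟨r / (‖toR z‖ + 1), by positivity, ?_⟩
    rw [div_mul_eq_mul_div, div_lt_iff₀ (by positivity)]
    nlinarith [norm_nonneg (toR z)]
  have hmem : (-t) • toR z ∈ affineSpan ℝ U₀ := by
    have := AffineMap.lineMap_mem (-t) hI0 (subset_affineSpan ℝ U₀ hz.2)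
    simpa [AffineMap.lineMap_apply] using this
  have h1 : (-t) • toR z ∈ U₀ := by
    refine hI _ hmem ?_
    rw [dist_zero_right, norm_smul]
    simpa [abs_of_pos ht] using htr
  have h2 : (-t) • toR z ∈ Cp R := by
    refine convexHull_min ?_ Cp_convex (hF.1 h1)
    rintro _ ⟨w, hw, rfl⟩
    exact mem_Cp hw
  obtain ⟨b, hb, hbe⟩ := h2
  have hsum : ∑ w ∈ R, (b w + if w = z then t else 0) • toR w = 0 := by
    simp only [add_smul, Finset.sum_add_distrib, ← hbe, ite_smul, zero_smul,
      Finset.sum_ite_eq', hz.1, if_true]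
    simp
  obtain ⟨m, hm, hm'⟩ := dirichlet (R := R) (fun w => b w + if w = z then t else 0)
    (fun w => add_nonneg (hb w) (by split_ifs; exacts [ht.le, le_rfl])) hsum
  have hmz := hm' z hz.1 (by simp; linarith [hb z])
  obtain ⟨l, hl⟩ := list_of_nat (R := R) R le_rfl (fun w => m w - if w = z then 1 else 0)
  refine ⟨l, ?_⟩
  have hsplit : ∑ w ∈ R, m w • w = (∑ w ∈ R, (m w - if w = z then 1 else 0) • w) + z := by
    rw [← Finset.add_sum_erase _ _ hz.1, ← Finset.add_sum_erase _ _ hz.1]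
    have : ∑ x ∈ R.erase z, (m x - if x = z then 1 else 0) • x = ∑ x ∈ R.erase z, m x • x := by
      refine Finset.sum_congr rfl fun x hx => ?_
      simp [Finset.ne_of_mem_erase hx]
    rw [this]
    obtain ⟨k, hk⟩ : ∃ k, m z = k + 1 := ⟨m z - 1, by omega⟩
    simp [hk]
    ring
  rw [hl, eq_neg_iff_add_eq_zero, ← hsplit, hm]

end geom
end RWRP

namespace RWRP

section geom2

variable {d : ℕ} {R : Finset (Zd d)}

theorem norm_le_n1 (ξ : Fin d → ℝ) : ‖ξ‖ ≤ n1 ξ := by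
  rw [n1, pi_norm_le_iff_of_nonneg (Finset.sum_nonneg fun _ _ => abs_nonneg _)]
  intro i
  exact Finset.single_le_sum (f := fun i => |ξ i|) (fun _ _ => abs_nonneg _) (Finset.mem_univ i)

theorem n1_nonneg (ξ : Fin d → ℝ) : 0 ≤ n1 ξ := Finset.sum_nonneg fun _ _ => abs_nonneg _

theorem length_bound (S : Finset (Zd d))
    (hneg : ∀ z ∈ S, ∃ l : List {z : Zd d // z ∈ S}, LS l = -z) :
    ∃ C : ℝ, 0 ≤ C ∧ ∀ l : List {z : Zd d // z ∈ S}, ∃ l' : List {z : Zd d // z ∈ S},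
      LS l' = LS l ∧ (l'.length : ℝ) ≤ C * (n1Z (LS l) + 1) := by
  choose! f hf using hneg
  -- uniform bound for inverse steps
  obtain ⟨N0, hN0, hN01⟩ : ∃ N0 : ℕ, (∀ z ∈ S, (f z).length ≤ N0) ∧ 1 ≤ N0 :=
    ⟨S.sup (fun z => (f z).length) + 1,
      fun z hz => (Finset.le_sup (f := fun z => (f z).length) hz).trans (by omega), by omega⟩
  have hpow : ∀ z ∈ S, ∀ k : ℕ, (∃ l : List {z : Zd d // z ∈ S}, LS l = k • z ∧ l.length ≤ k * N0) ∧
      (∃ l : List {z : Zd d // z ∈ S}, LS l = -(k • z) ∧ l.length ≤ k * N0) := by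
    intro z hz k
    induction k with
    | zero => exact ⟨⟨[], by simp [LS]⟩, ⟨[], by simp [LS]⟩⟩
    | succ k ih =>
      obtain ⟨⟨a, ha, ha'⟩, ⟨b, hb, hb'⟩⟩ := ih
      refine ⟨⟨⟨z, hz⟩ :: a, ?_, ?_⟩, ⟨f z ++ b, ?_, ?_⟩⟩
      · rw [LS, ha, succ_nsmul, add_comm]
      · rw [List.length_cons]; nlinarith
      · rw [LS_append, hb, hf z hz, succ_nsmul]; abel
      · rw [List.length_append]; nlinarith [hN0 z hz]
  have hzpow : ∀ z ∈ S, ∀ k : ℤ,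
      ∃ l : List {z : Zd d // z ∈ S}, LS l = k • z ∧ l.length ≤ k.natAbs * N0 := by
    intro z hz k
    rcases Int.natAbs_eq k with h | h
    · obtain ⟨l, hl, hl'⟩ := (hpow z hz k.natAbs).1
      refine ⟨l, ?_, hl'⟩
      rw [hl, h]; simp
    · obtain ⟨l, hl, hl'⟩ := (hpow z hz k.natAbs).2
      refine ⟨l, ?_, hl'⟩
      rw [hl]
      conv_rhs => rw [h]
      simp
  have hcomb : ∀ (S' : Finset (Zd d)), S' ⊆ S → ∀ k : Zd d → ℤ,
      ∃ l : List {z : Zd d // z ∈ S}, LS l = ∑ z ∈ S', k z • z ∧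
        l.length ≤ ∑ z ∈ S', (k z).natAbs * N0 := by
    intro S' hS' k
    induction S' using Finset.induction_on with
    | empty => exact ⟨[], by simp [LS]⟩
    | insert z S' hz ih =>
      obtain ⟨l, hl, hl'⟩ := ih (fun x hx => hS' (by simp [hx]))
      obtain ⟨a, ha, ha'⟩ := hzpow z (hS' (by simp)) (k z)
      refine ⟨a ++ l, ?_, ?_⟩
      · rw [LS_append, Finset.sum_insert hz, ha, hl]
      · rw [List.length_append, Finset.sum_insert hz]; omega
  -- real coefficients
  let L : ((S → ℝ)) →ₗ[ℝ] (Fin d → ℝ) :=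
    { toFun := fun c => ∑ w : S, c w • toR (w : Zd d)
      map_add' := by intro a b; simp [add_smul, Finset.sum_add_distrib]
      map_smul' := by intro a b; simp [Finset.smul_sum, mul_smul] }
  obtain ⟨C1, hC1, hpre⟩ := (LinearMap.toContinuousLinearMap L.rangeRestrict).exists_preimage_norm_le
    (by simpa using L.surjective_rangeRestrict)
  have hrange : ∀ l : List {z : Zd d // z ∈ S}, toR (LS l) ∈ LinearMap.range L := by
    intro l
    induction l with
    | nil => rw [LS, toR_zero]; exact zero_mem _
    | cons z l ih =>
      rw [LS, toR_add]
      refine add_mem ⟨Pi.single z 1, ?_⟩ ih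
      simp [L, Pi.single_apply]
  set B : ℝ := ∑ z ∈ S, ‖toR z‖ with hB
  have hfin : {y : Zd d | ‖toR y‖ ≤ B}.Finite := by
    refine (Set.Finite.subset (Set.finite_Icc (fun _ => -⌈B⌉ : Zd d) (fun _ => ⌈B⌉))) ?_
    intro y hy
    have h1 : ∀ i, |(y i : ℝ)| ≤ B := fun i => (norm_le_pi_norm (toR y) i).trans hy
    constructor
    · intro i
      have := (abs_le.1 (h1 i)).1
      have h2 := Int.le_ceil B
      have : (-(⌈B⌉ : ℤ) : ℝ) ≤ y i := by linarith
      exact_mod_cast this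
    · intro i
      have := (abs_le.1 (h1 i)).2
      have h2 := Int.le_ceil B
      have : (y i : ℝ) ≤ (⌈B⌉ : ℤ) := by linarith
      exact_mod_cast this
  obtain ⟨N1, hN1⟩ : ∃ N1 : ℕ, ∀ y : Zd d, ‖toR y‖ ≤ B →
      (∃ l : List {z : Zd d // z ∈ S}, LS l = y) →
      ∃ l : List {z : Zd d // z ∈ S}, LS l = y ∧ l.length ≤ N1 := by
    have : ∀ y : Zd d, ∃ l : List {z : Zd d // z ∈ S},
      (∃ l : List {z : Zd d // z ∈ S}, LS l = y) → LS l = y := by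
      intro y
      by_cases h : ∃ l : List {z : Zd d // z ∈ S}, LS l = y
      · obtain ⟨l, hl⟩ := h; exact ⟨l, fun _ => hl⟩
      · exact ⟨[], fun h' => (h h').elim⟩
    choose g hg using this
    refine ⟨hfin.toFinset.sup (fun y => (g y).length), fun y hy h => ⟨g y, hg y h, ?_⟩⟩
    exact Finset.le_sup (f := fun y => (g y).length) (by simpa using hy)
  refine ⟨N1 + (S.card : ℝ) * N0 * (C1 + 1), by positivity, ?_⟩
  intro l
  obtain ⟨c, hc, hcn⟩ := hpre ⟨toR (LS l), hrange l⟩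
  have hc' : ∑ w : S, c w • toR (w : Zd d) = toR (LS l) := by
    have := congrArg Subtype.val hc
    exact this
  let k : Zd d → ℤ := fun z => if h : z ∈ S then ⌊c ⟨z, h⟩⌋ else 0
  have hk : ∀ w : S, k w = ⌊c w⌋ := fun w => by simp [k]
  obtain ⟨a, ha, ha'⟩ := hcomb S le_rfl k
  obtain ⟨a2, ha2, -⟩ := hcomb S le_rfl (fun z => - k z)
  have hres : ‖toR (LS (l ++ a2))‖ ≤ B := by
    have : toR (LS (l ++ a2)) = ∑ w : S, (Int.fract (c w)) • toR (w : Zd d) := by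
      rw [LS_append, ha2, toR_add, ← hc', toR_sum, ← Finset.sum_coe_sort S, ← Finset.sum_add_distrib]
      refine Finset.sum_congr rfl fun w _ => ?_
      rw [toR_zsmul, hk, ← add_smul, Int.fract]
      push_cast; rfl
    rw [this, hB, ← Finset.sum_coe_sort S]
    refine norm_sum_le_of_le _ fun w _ => ?_
    rw [norm_smul, Real.norm_eq_abs, abs_of_nonneg (Int.fract_nonneg _)]
    exact mul_le_of_le_one_left (norm_nonneg _) (Int.fract_lt_one _).le
  obtain ⟨b, hb, hb'⟩ := hN1 _ hres ⟨_, rfl⟩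
  refine ⟨b ++ a, ?_, ?_⟩
  · rw [LS_append, hb, LS_append, ha2, ha, add_assoc, ← Finset.sum_add_distrib]
    simp
  · have hn := norm_le_n1 (toR (LS l))
    have hcn' : ‖c‖ ≤ C1 * n1Z (LS l) := hcn.trans (by
      have : ‖(⟨toR (LS l), hrange l⟩ : LinearMap.range L)‖ = ‖toR (LS l)‖ := rfl
      rw [this, n1Z]; gcongr)
    have hkb : ∀ z ∈ S, ((k z).natAbs : ℝ) ≤ C1 * n1Z (LS l) + 1 := by
      intro z hz
      have e : k z = ⌊c ⟨z, hz⟩⌋ := hk ⟨z, hz⟩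
      rw [Nat.cast_natAbs, Int.cast_abs, e]
      have h1 : |c ⟨z, hz⟩| ≤ ‖c‖ := norm_le_pi_norm c ⟨z, hz⟩
      have h2 := Int.floor_le (c ⟨z, hz⟩)
      have h3 := Int.lt_floor_add_one (c ⟨z, hz⟩)
      have h4 := abs_le.1 h1
      rw [abs_le]
      constructor <;> linarith
    have h1 : ((b ++ a).length : ℝ) ≤ N1 + ∑ z ∈ S, ((k z).natAbs : ℝ) * N0 := by
      rw [List.length_append]
      have : b.length + a.length ≤ N1 + ∑ z ∈ S, (k z).natAbs * N0 := by omega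
      exact_mod_cast this
    have h2 : ∑ z ∈ S, ((k z).natAbs : ℝ) * N0 ≤ S.card * ((C1 * n1Z (LS l) + 1) * N0) := by
      rw [← nsmul_eq_mul]
      refine Finset.sum_le_card_nsmul _ _ _ fun z hz => ?_
      have := hkb z hz
      gcongr
    have h3 : 0 ≤ n1Z (LS l) := n1_nonneg _
    have h4 : (0 : ℝ) ≤ N1 * n1Z (LS l) := by positivity
    have h5 : (0 : ℝ) ≤ (S.card : ℝ) * N0 * (C1 + n1Z (LS l)) := by positivity
    nlinarith

/-! cones -/

theorem carath (n : ℕ) : ∀ (S : Finset (Zd d)), S.card = n → ∀ (b : Zd d → ℝ), (∀ z, 0 ≤ b z) →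
    ∃ S' ⊆ S, LinearIndependent ℝ (fun z : S' => toR (z : Zd d)) ∧
      ∃ b' : Zd d → ℝ, (∀ z, 0 ≤ b' z) ∧ ∑ z ∈ S, b z • toR z = ∑ z ∈ S', b' z • toR z := by
  induction n with
  | zero =>
    intro S hS b hb
    have : S = ∅ := Finset.card_eq_zero.1 hS
    subst this
    exact ⟨∅, le_rfl, linearIndependent_empty_type, b, hb, rfl⟩
  | succ n ih =>
    intro S hS b hb
    by_cases hli : LinearIndependent ℝ (fun z : S => toR (z : Zd d))
    · exact ⟨S, le_rfl, hli, b, hb, rfl⟩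
    have : ∃ g : Zd d → ℝ, ∑ z ∈ S, g z • toR z = 0 ∧ ∃ z ∈ S, 0 < g z := by
      rw [Fintype.not_linearIndependent_iff] at hli
      obtain ⟨g, hg, i, hi⟩ := hli
      let G : Zd d → ℝ := fun z => if h : z ∈ S then g ⟨z, h⟩ else 0
      have hG : ∑ z ∈ S, G z • toR z = 0 := by
        rw [← Finset.sum_coe_sort S, ← hg]
        refine Finset.sum_congr rfl fun w _ => ?_
        simp [G]
      have hGi : G i = g i := by simp [G]
      rcases lt_or_gt_of_ne hi with h | h
      · refine ⟨fun z => - G z, ?_, i, i.2, by show 0 < - G i; rw [hGi]; linarith⟩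
        simp only [neg_smul, Finset.sum_neg_distrib, hG, neg_zero]
      · exact ⟨G, hG, i, i.2, by rw [hGi]; exact h⟩
    obtain ⟨g, hg, z0, hz0, hgz0⟩ := this
    obtain ⟨z1, hz1, hmin⟩ := Finset.exists_min_image (S.filter (fun z => 0 < g z))
      (fun z => b z / g z) ⟨z0, by simp [hz0, hgz0]⟩
    rw [Finset.mem_filter] at hz1
    set r := b z1 / g z1
    have hr : 0 ≤ r := div_nonneg (hb _) hz1.2.le
    let b2 : Zd d → ℝ := fun z => if z ∈ S then b z - r * g z else 0
    have hb2 : ∀ z, 0 ≤ b2 z := by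
      intro z
      by_cases hz : z ∈ S
      · simp only [b2, hz, if_true]
        by_cases hgz : 0 < g z
        · have := hmin z (by simp [hz, hgz])
          rw [le_div_iff₀ hgz] at this
          linarith
        · have := hb z
          nlinarith
      · simp [b2, hz]
    have hb21 : b2 z1 = 0 := by
      simp only [b2, hz1.1, if_true, r]
      have := hz1.2.ne'
      field_simp; ring
    have hsum : ∑ z ∈ S, b z • toR z = ∑ z ∈ S.erase z1, b2 z • toR z := by
      have e1 : ∑ z ∈ S, b2 z • toR z = ∑ z ∈ S, b z • toR z := by
        have : ∀ z ∈ S, b2 z • toR z = b z • toR z - r • (g z • toR z) := by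
          intro z hz
          simp only [b2, hz, if_true, sub_smul, mul_smul]
        rw [Finset.sum_congr rfl this, Finset.sum_sub_distrib, ← Finset.smul_sum, hg]
        simp
      rw [← e1, ← Finset.add_sum_erase _ _ hz1.1, hb21]
      simp
    obtain ⟨S', hS', h1, b', hb', h2⟩ := ih (S.erase z1)
      (by rw [Finset.card_erase_of_mem hz1.1]; omega) b2 hb2
    exact ⟨S', hS'.trans (Finset.erase_subset _ _), h1, b', hb', hsum.trans h2⟩

theorem Cp_closed (R : Finset (Zd d)) : IsClosed (Cp R) := by
  have : Cp R = ⋃ S' ∈ {S' : Finset (Zd d) | S' ⊆ R ∧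
      LinearIndependent ℝ (fun z : S' => toR (z : Zd d))}, Cp S' := by
    ext ξ
    simp only [Set.mem_iUnion, Set.mem_ofPred_eq]
    constructor
    · rintro ⟨b, hb, rfl⟩
      obtain ⟨S', hS', h1, b', hb', h2⟩ := carath _ R rfl b hb
      exact ⟨S', ⟨hS', h1⟩, b', hb', h2⟩
    · rintro ⟨S', ⟨hS', h1⟩, b', hb', rfl⟩
      refine ⟨fun z => if z ∈ S' then b' z else 0, fun z => ?_, ?_⟩
      · dsimp only
        split_ifs
        · exact hb' z
        · exact le_rfl
      · simp only [ite_smul, zero_smul]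
        rw [Finset.sum_ite_mem, Finset.inter_eq_right.2 hS']
  rw [this]
  refine Set.Finite.isClosed_biUnion ?_ ?_
  · exact (Finset.finite_toSet R.powerset).subset (fun S' hS' => by simpa using hS'.1)
  · rintro S' ⟨_, hli⟩
    have hinj := hli.fintypeLinearCombination_injective
    have hce := (Fintype.linearCombination ℝ
      (fun z : S' => toR (z : Zd d))).isClosedEmbedding_of_injective (LinearMap.ker_eq_bot.2 hinj)
    have : Cp S' = (Fintype.linearCombination ℝ (fun z : S' => toR (z : Zd d))) '' Set.Ici 0 := by
      ext ξ
      constructor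
      · rintro ⟨b, hb, rfl⟩
        refine ⟨fun z => b z, fun z => hb z, ?_⟩
        rw [Fintype.linearCombination_apply, Finset.sum_coe_sort S' (fun z => b z • toR z)]
      · rintro ⟨c, hc, rfl⟩
        refine ⟨fun z => if h : z ∈ S' then c ⟨z, h⟩ else 0, fun z => ?_, ?_⟩
        · dsimp only
          split_ifs with h
          · exact hc ⟨z, h⟩
          · exact le_rfl
        · rw [Fintype.linearCombination_apply, ← Finset.sum_coe_sort S']
          refine Finset.sum_congr rfl fun w _ => ?_
          simp
    rw [this]
    exact hce.isClosedMap _ isClosed_Ici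

theorem Cp_smul {ξ : Fin d → ℝ} (h : ξ ∈ Cp R) {c : ℝ} (hc : 0 ≤ c) : c • ξ ∈ Cp R := by
  obtain ⟨b, hb, rfl⟩ := h
  exact ⟨fun z => c * b z, fun z => mul_nonneg hc (hb z), by simp [Finset.smul_sum, mul_smul]⟩

theorem Cp_zero : (0 : Fin d → ℝ) ∈ Cp R := ⟨fun _ => 0, fun _ => le_rfl, by simp⟩

section face
variable {A : Set (Fin d → ℝ)}

theorem face_smul_gt (hA : IsFace (Cp R) A) {ξ : Fin d → ℝ} (h : ξ ∈ A) {c : ℝ} (hc : 1 < c) :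
    c • ξ ∈ A ∧ (0 : Fin d → ℝ) ∈ A := by
  refine hA.2.2 h (Cp_smul (hA.1 h) (by linarith)) Cp_zero (t := c⁻¹)
    ⟨by positivity, inv_lt_one_of_one_lt₀ hc⟩ ?_
  rw [smul_smul, inv_mul_cancel₀ (by positivity)]; simp

theorem face_smul (hA : IsFace (Cp R) A) {ξ : Fin d → ℝ} (h : ξ ∈ A) {c : ℝ} (hc : 0 ≤ c) : c • ξ ∈ A := by
  rcases lt_or_ge 1 c with h1 | h1
  · exact (face_smul_gt hA h h1).1
  · have h0 := (face_smul_gt hA h one_lt_two).2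
    have := hA.2.1 h h0 hc (sub_nonneg.2 h1) (by ring)
    simpa using this

theorem face_add (hA : IsFace (Cp R) A) {ξ η : Fin d → ℝ} (h : ξ ∈ A) (h' : η ∈ A) : ξ + η ∈ A := by
  have hh : (1/2 : ℝ) • ξ + (1/2 : ℝ) • η ∈ A :=
    hA.2.1 h h' (by norm_num) (by norm_num) (by norm_num)
  have := face_smul hA hh (c := 2) (by norm_num)
  simpa [smul_add, smul_smul] using this

theorem face_sum (hA : IsFace (Cp R) A) {ξ : Fin d → ℝ} (h : ξ ∈ A) {ι : Type*} (s : Finset ι) (f : ι → Fin d → ℝ)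
    (hf : ∀ i ∈ s, f i ∈ A) : ∑ i ∈ s, f i ∈ A := by
  induction s using Finset.induction_on with
  | empty => simpa using face_smul hA h (c := 0) le_rfl
  | insert i s hi ih =>
    rw [Finset.sum_insert hi]
    exact face_add hA (hf i (by simp)) (ih fun j hj => hf j (by simp [hj]))

theorem face_mem (hA : IsFace (Cp R) A) {b : Zd d → ℝ} (hb : ∀ z, 0 ≤ b z) (h : ∑ z ∈ R, b z • toR z ∈ A) {z : Zd d}
    (hz : z ∈ R) (hbz : 0 < b z) : toR z ∈ A := by
  have h1 : (2 * b z) • toR z ∈ Cp R := Cp_smul (mem_Cp hz) (by positivity)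
  have h2 : (2 : ℝ) • ∑ w ∈ R.erase z, b w • toR w ∈ Cp R := by
    refine Cp_smul ⟨fun w => if w = z then 0 else b w, fun w => ?_, ?_⟩ (by norm_num)
    · dsimp only
      split_ifs
      · exact le_rfl
      · exact hb w
    · rw [← Finset.add_sum_erase _ _ hz]
      simp only [if_true, zero_smul, zero_add]
      refine Finset.sum_congr rfl fun w hw => ?_
      rw [if_neg (Finset.ne_of_mem_erase hw)]
  have := (hA.2.2 h h1 h2 (t := 1/2) (by norm_num) (by
    rw [← Finset.add_sum_erase _ _ hz]
    simp only [smul_smul]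
    congr 1
    · congr 1; ring
    · norm_num)).1
  have := face_smul hA this (c := (2 * b z)⁻¹) (by positivity)
  rwa [smul_smul, inv_mul_cancel₀ (by positivity), one_smul] at this

theorem face_closed (hA : IsFace (Cp R) A) : IsClosed A := by
  rcases A.eq_empty_or_nonempty with rfl | ⟨ξ0, hξ0⟩
  · exact isClosed_empty
  have : A = Cp (R.filter (fun z => toR z ∈ A)) := by
    ext ξ
    constructor
    · intro h
      obtain ⟨b, hb, rfl⟩ := hA.1 h
      refine ⟨b, hb, ?_⟩
      rw [Finset.sum_filter]
      refine Finset.sum_congr rfl fun z hz => ?_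
      split_ifs with hzA
      · rfl
      · have : b z = 0 := by
          by_contra hne
          exact hzA (face_mem hA hb h hz (lt_of_le_of_ne (hb z) (Ne.symm hne)))
        simp [this]
    · rintro ⟨b, hb, rfl⟩
      refine face_sum hA hξ0 _ _ fun z hz => face_smul hA ?_ (hb z)
      exact (Finset.mem_filter.1 hz).2
  rw [this]
  exact Cp_closed _

theorem face_filler (hA : IsFace (Cp R) A) {ξ : Fin d → ℝ} (h : ξ ∈ A) : ∃ y : ℕ → Zd d,
    (∀ n, y n ∈ Gp R ∧ toR (y n) ∈ A) ∧
    Tendsto (fun n : ℕ => (n : ℝ)⁻¹ • toR (y n)) atTop (𝓝 ξ) := by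
  have h' := h
  obtain ⟨b, hb, rfl⟩ := hA.1 h
  refine ⟨fun n => ∑ z ∈ R, ⌊(n : ℝ) * b z⌋₊ • z, fun n => ⟨⟨_, rfl⟩, ?_⟩, ?_⟩
  · rw [toR_sum]
    refine face_sum hA h' _ _ fun z hz => ?_
    rw [toR_nsmul]
    rcases (hb z).eq_or_lt with h0 | h0
    · rw [← h0]; simpa using face_smul hA h' (c := 0) le_rfl
    · exact face_smul hA (face_mem hA hb h' hz h0) (by positivity)
  · simp only [toR_sum, toR_nsmul, Finset.smul_sum, smul_smul]
    refine tendsto_finsetSum _ fun z _ => ?_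
    refine Tendsto.smul_const ?_ _
    have := (tendsto_nat_floor_mul_div_atTop (hb z)).comp (tendsto_natCast_atTop_atTop (R := ℝ))
    refine this.congr fun n => ?_
    simp only [Function.comp]
    rw [mul_comm (b z), div_eq_inv_mul]

theorem relint_smul (hA : IsFace (Cp R) A) {ξ : Fin d → ℝ} (h : ξ ∈ intrinsicInterior ℝ A) {c : ℝ} (hc : 0 < c) :
    c • ξ ∈ intrinsicInterior ℝ A := by
  have hξA := intrinsicInterior_subset h
  have h0 : (0 : Fin d → ℝ) ∈ affineSpan ℝ A :=
    subset_affineSpan ℝ A (by simpa using face_smul hA hξA (c := 0) le_rfl)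
  have hs : ∀ (c : ℝ) y, y ∈ affineSpan ℝ A → c • y ∈ affineSpan ℝ A := by
    intro c y hy
    have := AffineMap.lineMap_mem c h0 hy
    simpa [AffineMap.lineMap_apply] using this
  rw [mem_relint] at h ⊢
  obtain ⟨h1, r, hr, h2⟩ := h
  refine ⟨hs _ _ h1, c * r, by positivity, fun y hy hd => ?_⟩
  have h3 : c⁻¹ • y ∈ A := by
    refine h2 _ (hs _ _ hy) ?_
    have : dist (c⁻¹ • y) ξ = c⁻¹ * dist y (c • ξ) := by
      have e : ξ = c⁻¹ • (c • ξ) := by rw [smul_smul, inv_mul_cancel₀ hc.ne', one_smul]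
      conv_lhs => rw [e]
      rw [dist_smul₀, Real.norm_eq_abs, abs_of_pos (by positivity)]
    rw [this, inv_mul_lt_iff₀ hc]
    exact hd
  have := face_smul hA h3 hc.le
  rwa [smul_smul, mul_inv_cancel₀ hc.ne', one_smul] at this

end face

end geom2
end RWRP

namespace RWRP

section shape

variable {d : ℕ} {R : Finset (Zd d)}

/-- integer ℓ¹ norm -/
def nN (x : Zd d) : ℕ := ∑ i, (x i).natAbs

theorem nN_eq (x : Zd d) : n1Z x = (nN x : ℝ) := by
  simp [n1Z, n1, toR, nN, Nat.cast_natAbs]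

theorem n1_zero : n1 (0 : Fin d → ℝ) = 0 := by simp [n1]

theorem n1_cont : Continuous (n1 : (Fin d → ℝ) → ℝ) := by
  unfold n1
  fun_prop

theorem n1_smul (c : ℝ) (ξ : Fin d → ℝ) : n1 (c • ξ) = |c| * n1 ξ := by
  simp [n1, abs_mul, Finset.mul_sum]

theorem n1_pos {ξ : Fin d → ℝ} (h : ξ ≠ 0) : 0 < n1 ξ :=
  (norm_pos_iff.2 h).trans_le (norm_le_n1 ξ)

theorem faceDelta_dist {A : Set (Fin d → ℝ)} {δ : ℝ} {ξ η : Fin d → ℝ} (h : ξ ∈ faceDelta A δ)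
    (hη : η ∈ A \ intrinsicInterior ℝ A) : δ ≤ n1 ((n1 ξ)⁻¹ • ξ - η) := by
  have h1 : ENNReal.ofReal δ ≤ ENNReal.ofReal (n1 ((n1 ξ)⁻¹ • ξ - η)) :=
    h.2.2.trans (iInf₂_le η hη)
  exact (ENNReal.ofReal_le_ofReal_iff (n1_nonneg _)).1 h1

theorem faceDelta_relint {A : Set (Fin d → ℝ)} (hA : IsFace (Cp R) A) {δ : ℝ} (hδ : 0 < δ)
    {ξ : Fin d → ℝ} (h : ξ ∈ faceDelta A δ) : ξ ∈ intrinsicInterior ℝ A := by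
  have hn := n1_pos h.2.1
  have hu : (n1 ξ)⁻¹ • ξ ∈ A := face_smul hA h.1 (by positivity)
  have hu' : (n1 ξ)⁻¹ • ξ ∈ intrinsicInterior ℝ A := by
    by_contra hc
    have := faceDelta_dist h ⟨hu, hc⟩
    rw [sub_self, n1_zero] at this
    linarith
  have := relint_smul hA hu' hn
  rwa [smul_smul, mul_inv_cancel₀ hn.ne', one_smul] at this

theorem Gp_nsmul {x : Zd d} (h : x ∈ Gp R) (m : ℕ) : m • x ∈ Gp R := by
  obtain ⟨b, rfl⟩ := h
  exact ⟨fun z => m * b z, by simp [Finset.mul_sum, mul_assoc]⟩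

theorem along {A : Set (Fin d → ℝ)} (hA : IsFace (Cp R) A) (a : Zd d → ℝ)
    (ξ : Fin d → ℝ) (αξ : ℝ) (hξ : ξ ∈ A)
    (hα : ∀ x : ℕ → Zd d, (∀ n, x n ∈ Gp R ∧ toR (x n) ∈ A) →
      Tendsto (fun n : ℕ => (n : ℝ)⁻¹ • toR (x n)) atTop (𝓝 ξ) →
      Tendsto (fun n : ℕ => a (x n) / n) atTop (𝓝 αξ))
    (y : ℕ → Zd d) (hy : ∀ k, y k ∈ Gp R ∧ toR (y k) ∈ A) (n : ℕ → ℕ) (hn : StrictMono n)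
    (hlim : Tendsto (fun k : ℕ => (n k : ℝ)⁻¹ • toR (y k)) atTop (𝓝 ξ)) :
    Tendsto (fun k : ℕ => a (y k) / n k) atTop (𝓝 αξ) := by
  obtain ⟨f, hf, hflim⟩ := face_filler hA hξ
  let Y : ℕ → Zd d := fun j => if h : ∃ k, n k = j then y h.choose else f j
  have hYn : ∀ k, Y (n k) = y k := by
    intro k
    have h : ∃ k', n k' = n k := ⟨k, rfl⟩
    have : h.choose = k := hn.injective h.choose_spec
    simp only [Y, h, dif_pos, this]
  have hY1 : ∀ j, Y j ∈ Gp R ∧ toR (Y j) ∈ A := by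
    intro j
    by_cases h : ∃ k, n k = j
    · obtain ⟨k, rfl⟩ := h
      rw [hYn]; exact hy k
    · simp only [Y, h, dif_neg, not_false_eq_true]; exact hf j
  have hY2 : Tendsto (fun j : ℕ => (j : ℝ)⁻¹ • toR (Y j)) atTop (𝓝 ξ) := by
    rw [tendsto_def]
    intro U hU
    have h1 := (tendsto_def.1 hflim) U hU
    have h2 := (tendsto_def.1 hlim) U hU
    rw [mem_atTop_sets] at h1 h2 ⊢
    obtain ⟨N1, h1⟩ := h1
    obtain ⟨N2, h2⟩ := h2
    refine ⟨max N1 (n N2), fun j hj => ?_⟩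
    show (j : ℝ)⁻¹ • toR (Y j) ∈ U
    by_cases h : ∃ k, n k = j
    · obtain ⟨k, rfl⟩ := h
      rw [hYn]
      exact h2 k (hn.le_iff_le.1 ((le_max_right _ _).trans hj))
    · simp only [Y, h, dif_neg, not_false_eq_true]
      exact h1 j ((le_max_left _ _).trans hj)
  have := (hα Y hY1 hY2).comp hn.tendsto_atTop
  refine this.congr fun k => ?_
  simp only [Function.comp, hYn]

theorem shape {A : Set (Fin d → ℝ)} (hA : IsFace (Cp R) A) (a : Zd d → ℝ)
    (α : (Fin d → ℝ) → ℝ)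
    (hα : ∀ ξ ∈ intrinsicInterior ℝ A, ∀ x : ℕ → Zd d,
      (∀ n, x n ∈ Gp R ∧ toR (x n) ∈ A) →
      Tendsto (fun n : ℕ => (n : ℝ)⁻¹ • toR (x n)) atTop (𝓝 ξ) →
      Tendsto (fun n : ℕ => a (x n) / n) atTop (𝓝 (α ξ)))
    (δ : ℝ) (hδ : 0 < δ) (ε : ℝ) (hε : 0 < ε) :
    ∃ M : ℝ, ∀ x ∈ Gp R, toR x ∈ faceDelta A δ → M ≤ n1Z x →
      |a x - α (toR x)| ≤ ε * n1Z x := by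
  by_contra hcon
  push Not at hcon
  choose x0 hx0G hx0A hx0n hx0 using fun k : ℕ => hcon (k + 1)
  -- compactness
  let u : ℕ → (Fin d → ℝ) := fun k => (n1 (toR (x0 k)))⁻¹ • toR (x0 k)
  have hu : ∀ k, u k ∈ Metric.closedBall (0 : Fin d → ℝ) 1 := by
    intro k
    rw [mem_closedBall_zero_iff]
    refine (norm_le_n1 _).trans ?_
    have := n1_pos (hx0A k).2.1
    rw [n1_smul, abs_of_pos (by positivity), inv_mul_cancel₀ this.ne']
  obtain ⟨ξ, _, φ, hφ, hlim0⟩ := (isCompact_closedBall (0 : Fin d → ℝ) 1).tendsto_subseq hu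
  have hNtop : Tendsto (fun k => nN (x0 (φ k))) atTop atTop := by
    refine tendsto_atTop_mono (fun k => ?_) tendsto_id
    have h1 := hx0n (φ k)
    rw [nN_eq] at h1
    have h2 : φ k ≤ nN (x0 (φ k)) := by
      have : (φ k : ℝ) ≤ nN (x0 (φ k)) := by linarith
      exact_mod_cast this
    exact (hφ.id_le k).trans h2
  obtain ⟨ψ, hψ, hψN⟩ := strictMono_subseq_of_tendsto_atTop hNtop
  let x : ℕ → Zd d := fun k => x0 (φ (ψ k))
  have hxN : StrictMono (fun k => nN (x k)) := hψN
  have hxG : ∀ k, x k ∈ Gp R := fun k => hx0G _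
  have hxA : ∀ k, toR (x k) ∈ faceDelta A δ := fun k => hx0A _
  have hlim : Tendsto (fun k => ((nN (x k) : ℝ))⁻¹ • toR (x k)) atTop (𝓝 ξ) := by
    refine (hlim0.comp hψ.tendsto_atTop).congr fun k => ?_
    simp only [Function.comp, u, x]
    rw [← nN_eq]; rfl
  have hξA : ξ ∈ A := (face_closed hA).mem_of_tendsto hlim
    (Eventually.of_forall fun k => face_smul hA (hxA k).1 (by positivity))
  have hξ : ξ ∈ intrinsicInterior ℝ A := by
    by_contra hc
    have h1 : Tendsto (fun k => n1 (((nN (x k) : ℝ))⁻¹ • toR (x k) - ξ)) atTop (𝓝 (n1 (ξ - ξ))) :=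
      (n1_cont.tendsto _).comp (hlim.sub_const ξ)
    rw [sub_self, n1_zero] at h1
    have : δ ≤ 0 := ge_of_tendsto h1 (Eventually.of_forall fun k => by
      have := faceDelta_dist (hxA k) ⟨hξA, hc⟩
      rw [← nN_eq]; exact this)
    linarith
  have hpos : ∀ k, 0 < nN (x k) := by
    intro k
    have h1 := hx0n (φ (ψ k))
    rw [nN_eq] at h1
    have : (0 : ℝ) < nN (x k) := lt_of_lt_of_le (by positivity) h1
    exact_mod_cast this
  have lim1 := along hA a ξ (α ξ) hξA (hα ξ hξ) x (fun k => ⟨hxG k, (hxA k).1⟩) _ hxN hlim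
  -- multiples
  have hm : ∀ k, ∃ m : ℕ, 0 < m ∧ |a (m • x k) / m - α (toR (x k))| ≤ 1 := by
    intro k
    have h1 := hα (toR (x k)) (faceDelta_relint hA hδ (hxA k)) (fun m => m • x k)
      (fun m => ⟨Gp_nsmul (hxG k) m, by
        rw [toR_nsmul]; exact face_smul hA (hxA k).1 (by positivity)⟩)
      (by
        refine tendsto_const_nhds.congr' ?_
        filter_upwards [eventually_gt_atTop 0] with m hm
        have : (m : ℝ) ≠ 0 := by positivity
        rw [toR_nsmul, smul_smul, inv_mul_cancel₀ this, one_smul])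
    obtain ⟨m, h2, h3⟩ := ((Metric.tendsto_nhds.1 h1 1 one_pos).and (eventually_gt_atTop 0)).exists
    exact ⟨m, h3, h2.le⟩
  choose m hm0 hm using hm
  have htop2 : Tendsto (fun k => m k * nN (x k)) atTop atTop := by
    refine tendsto_atTop_mono (fun k => ?_) hxN.tendsto_atTop
    exact Nat.le_mul_of_pos_left _ (hm0 k)
  obtain ⟨θ, hθ, hθN⟩ := strictMono_subseq_of_tendsto_atTop htop2
  have lim2 := along hA a ξ (α ξ) hξA (hα ξ hξ) (fun k => m (θ k) • x (θ k))
    (fun k => ⟨Gp_nsmul (hxG _) _, by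
        rw [toR_nsmul]; exact face_smul hA (hxA _).1 (by positivity)⟩) _ hθN (by
      refine (hlim.comp hθ.tendsto_atTop).congr fun k => ?_
      have : (m (θ k) : ℝ) ≠ 0 := by exact_mod_cast (hm0 _).ne'
      simp only [Function.comp, Nat.cast_mul, toR_nsmul, smul_smul]
      congr 1
      field_simp)
  have lim1' := lim1.comp hθ.tendsto_atTop
  have lim3 : Tendsto (fun k => ((nN (x (θ k)) : ℝ))⁻¹) atTop (𝓝 0) :=
    tendsto_inv_atTop_zero.comp (tendsto_natCast_atTop_atTop.comp
      (hxN.tendsto_atTop.comp hθ.tendsto_atTop))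
  have lim4 := ((lim1'.sub lim2).abs).add lim3
  rw [sub_self, abs_zero, add_zero] at lim4
  have : ε ≤ 0 := by
    refine ge_of_tendsto lim4 (Eventually.of_forall fun k => ?_)
    have h1 := hx0 (φ (ψ (θ k)))
    have h2 := hm (θ k)
    have h3 : (0 : ℝ) < nN (x (θ k)) := by exact_mod_cast hpos (θ k)
    have h4 : (0 : ℝ) < m (θ k) := by exact_mod_cast hm0 (θ k)
    rw [nN_eq] at h1
    change ε * nN (x (θ k)) < |a (x (θ k)) - α (toR (x (θ k)))| at h1
    simp only [Function.comp, Nat.cast_mul]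
    set N : ℝ := (nN (x (θ k)) : ℝ)
    set c := a (m (θ k) • x (θ k)) / m (θ k)
    have e : a (m (θ k) • x (θ k)) / (m (θ k) * N) = c / N := by
      simp only [c]; field_simp
    rw [e, ← sub_div, abs_div, abs_of_pos h3, inv_eq_one_div, ← add_div, le_div_iff₀ h3]
    have := abs_sub_le (a (x (θ k))) c (α (toR (x (θ k))))
    linarith
  linarith

end shape
end RWRP

namespace RWRP

section green

variable {d : ℕ} {R : Finset (Zd d)} {Ω : Type*}

theorem list_lift {S : Finset (Zd d)} (l : List {z : Zd d // z ∈ R})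
    (h : ∀ z ∈ l, (z : Zd d) ∈ S) :
    ∃ l' : List {z : Zd d // z ∈ S}, LS l' = LS l ∧ l'.length = l.length := by
  induction l with
  | nil => exact ⟨[], rfl, rfl⟩
  | cons z l ih =>
    obtain ⟨l', h1, h2⟩ := ih (fun w hw => h w (by simp [hw]))
    exact ⟨⟨z, h z (by simp)⟩ :: l', by simp [LS, h1], by simp [h2]⟩

theorem list_of_GpS {S : Finset (Zd d)} {y : Zd d} (h : y ∈ GpS (S : Set (Zd d))) :
    ∃ l : List {z : Zd d // z ∈ S}, LS l = y := by
  obtain ⟨m, c, hc, rfl⟩ := h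
  induction m with
  | zero => exact ⟨[], by simp [LS]⟩
  | succ m ih =>
    obtain ⟨l, hl⟩ := ih (fun i => c i.succ) (fun i => hc _)
    exact ⟨⟨c 0, hc 0⟩ :: l, by rw [LS, hl, Fin.sum_univ_succ]⟩

theorem list_neg {S : Finset (Zd d)} (hneg : ∀ z ∈ S, ∃ l : List {z : Zd d // z ∈ S}, LS l = -z)
    (l : List {z : Zd d // z ∈ S}) : ∃ l' : List {z : Zd d // z ∈ S}, LS l' = -LS l := by
  induction l with
  | nil => exact ⟨[], by simp [LS]⟩
  | cons z l ih =>
    obtain ⟨a, ha⟩ := ih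
    obtain ⟨b, hb⟩ := hneg z z.2
    exact ⟨a ++ b, by rw [LS_append, ha, hb, LS]; abel⟩

theorem n1Z_add_le (x y : Zd d) : n1Z (x + y) ≤ n1Z x + n1Z y := by
  simp only [n1Z, n1, toR_add, ← Finset.sum_add_distrib]
  exact Finset.sum_le_sum fun i _ => abs_add_le _ _

theorem n1Z_neg (x : Zd d) : n1Z (-x) = n1Z x := by
  simp [n1Z, n1, toR_neg]

/-- conclusion on diagonal Green function -/
def DiagGood (R : Finset (Zd d)) (w : Zd d → Zd d → ℝ≥0∞) : Prop :=
  ∀ ε > (0 : ℝ), ∃ M : ℝ, ∀ x, M ≤ n1Z x → GRL R w x x ≠ ⊤ ∧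
    Real.log (GRL R w x x).toReal ≤ ε * n1Z x

theorem GRL_ge_one (w : Zd d → Zd d → ℝ≥0∞) (x : Zd d) : 1 ≤ GRL R w x x := by
  rw [GRL]
  refine le_trans ?_ (ENNReal.le_tsum ([] : List {z : Zd d // z ∈ R}))
  simp [LS, LW]

theorem log_of_q (w : Zd d → Zd d → ℝ≥0∞) (hw : ∀ x z, w x z ≠ ⊤) (x : Zd d) (q : ℝ) (hq : 0 < q)
    (h : KL R w x x + ENNReal.ofReal q ≤ 1) :
    GRL R w x x ≠ ⊤ ∧ Real.log (GRL R w x x).toReal ≤ - Real.log q := by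
  have h1 := GRL_bound w hw x _ h
  have hq0 : ENNReal.ofReal q ≠ 0 := by simpa using hq
  have hne : GRL R w x x ≠ ⊤ := by
    intro ht
    rw [ht, ENNReal.mul_top hq0] at h1
    simp at h1
  refine ⟨hne, ?_⟩
  have h2 : q * (GRL R w x x).toReal ≤ 1 := by
    have := ENNReal.toReal_mono ENNReal.one_ne_top h1
    rwa [ENNReal.toReal_mul, ENNReal.toReal_ofReal hq.le, ENNReal.toReal_one] at this
  have h3 : 1 ≤ (GRL R w x x).toReal := by
    have := ENNReal.toReal_mono hne (GRL_ge_one (R := R) w x)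
    simpa using this
  have h4 := Real.log_nonpos (by positivity) h2
  rw [Real.log_mul hq.ne' (by positivity)] at h4
  linarith

theorem wgt_ne_top (T : Zd d → Ω → Ω) (V : Ω → Zd d → ℝ) (p : Zd d → ℝ) (ω : Ω) (x z : Zd d) :
    wgt T V p ω x z ≠ ⊤ := ENNReal.mul_ne_top ENNReal.ofReal_ne_top ENNReal.ofReal_ne_top

theorem wgt_le (T : Zd d → Ω → Ω) (V : Ω → Zd d → ℝ) (p : Zd d → ℝ) (ω : Ω) (x z : Zd d) (c : ℝ)
    (h : c ≤ V (T x ω) z) :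
    wgt T V p ω x z ≤ ENNReal.ofReal (Real.exp (-c)) * ENNReal.ofReal (p z) := by
  rw [wgt, mul_comm]
  gcongr

theorem diag_transient (T : Zd d → Ω → Ω) (V : Ω → Zd d → ℝ) (p : Zd d → ℝ) (ω : Ω)
    {U₀ : Set (Fin d → ℝ)} (hU₀ : IsZeroFace R U₀)
    (hpos : ∀ x, ∀ z ∈ R0 R U₀, 0 ≤ V (T x ω) z) (hret : retP p R < 1) :
    DiagGood R (wgt T V p ω) := by
  rw [retP_eq] at hret
  set r := KL R (fun _ z => ENNReal.ofReal (p z)) 0 0 with hr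
  have hrt : r ≠ ⊤ := hret.ne_top
  have hr1 : r.toReal < 1 := by
    have := (ENNReal.toReal_lt_toReal hrt ENNReal.one_ne_top).2 hret
    simpa using this
  have key : ∀ x, KL R (wgt T V p ω) x x + ENNReal.ofReal (1 - r.toReal) ≤ 1 := by
    intro x
    have h1 : KL R (wgt T V p ω) x x ≤ r := by
      refine KL_le_KL (wgt T V p ω) (fun z => ENNReal.ofReal (p z)) (R0 R U₀) ?_ x
        (fun l hl => loop_R0 hU₀ l hl)
      intro y z hz
      simpa using wgt_le T V p ω y z 0 (hpos y z hz)
    calc _ ≤ r + ENNReal.ofReal (1 - r.toReal) := by gcongr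
      _ = 1 := by
        conv_lhs => rw [← ENNReal.ofReal_toReal hrt]
        rw [ENNReal.toReal_ofReal (by positivity),
          ← ENNReal.ofReal_add (by positivity) (by linarith)]
        simp
  intro ε hε
  refine ⟨- Real.log (1 - r.toReal) / ε, fun x hx => ?_⟩
  obtain ⟨h1, h2⟩ := log_of_q (R := R) _ (wgt_ne_top T V p ω) x _ (by linarith) (key x)
  refine ⟨h1, h2.trans ?_⟩
  rw [div_le_iff₀ hε] at hx
  linarith

theorem diag_recurrent (T : Zd d → Ω → Ω) (hT : ∀ x y : Zd d, T (x + y) = T x ∘ T y)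
    (V : Ω → Zd d → ℝ) (p : Zd d → ℝ)
    (hp : ∀ z ∈ R, 0 < p z ∧ p z < 1) (hp1 : ∑ z ∈ R, p z = 1) (ω : Ω)
    {U₀ : Set (Fin d → ℝ)} (hU₀ : IsZeroFace R U₀)
    (hpos : ∀ x, ∀ z ∈ R0 R U₀, 0 ≤ V (T x ω) z) (ε : ℝ) (hε : 0 < ε)
    (hR : ∀ η > (0 : ℝ), ∃ M : ℝ, ∀ x, M ≤ n1Z x →
      Reps T V (R0 R U₀) ε (T x ω) ≤ ENNReal.ofReal (η * n1Z x)) :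
    DiagGood R (wgt T V p ω) := by
  have hRne : R.Nonempty := by
    rw [Finset.nonempty_iff_ne_empty]; rintro rfl; simp at hp1
  -- minimal step probability
  obtain ⟨z0, hz0, hmin⟩ := Finset.exists_min_image R p hRne
  set pm := p z0
  have hpm := hp z0 hz0
  set S : Finset (Zd d) := R.filter (fun z => z ∈ R0 R U₀) with hS
  have hSR : (S : Set (Zd d)) = R0 R U₀ := by
    ext z; rw [Finset.mem_coe, hS, Finset.mem_filter]; exact ⟨fun h => h.2, fun h => ⟨h.1, h⟩⟩
  have hneg : ∀ z ∈ S, ∃ l : List {z : Zd d // z ∈ S}, LS l = -z := by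
    intro z hz
    rw [hS, Finset.mem_filter] at hz
    obtain ⟨l, hl⟩ := neg_exists hU₀ z hz.2
    have := loop_R0 hU₀ (⟨z, hz.1⟩ :: l) (by rw [LS, hl]; simp)
    obtain ⟨l', h1, _⟩ := list_lift (S := S) l (fun w hw => by
      rw [hS, Finset.mem_filter]; exact ⟨w.2, this w (by simp [hw])⟩)
    exact ⟨l', h1.trans hl⟩
  obtain ⟨C, hC, hlen⟩ := length_bound S hneg
  obtain ⟨D, hD⟩ : ∃ D : ℝ, ∀ z ∈ R, n1Z z ≤ D :=
    ⟨∑ z ∈ R, n1Z z, fun z hz => Finset.single_le_sum (f := n1Z) (fun _ _ => n1_nonneg _) hz⟩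
  have hD0 : 0 ≤ D := (n1_nonneg _).trans (hD z0 hz0)
  set c := Real.exp (-ε)
  have hc1 : c < 1 := by simpa [c] using hε
  have hc0 : 0 < c := Real.exp_pos _
  -- the main estimate
  have main : ∀ x : Zd d, ∀ s : ℝ, 0 ≤ s → Reps T V (R0 R U₀) ε (T x ω) ≤ ENNReal.ofReal s →
      GRL R (wgt T V p ω) x x ≠ ⊤ ∧ Real.log (GRL R (wgt T V p ω) x x).toReal ≤
        (2 * C * s + C * (D + 4) + 1) * (- Real.log pm) - Real.log (1 - c) := by
    intro x s hs hRx
    have h1 : Reps T V (R0 R U₀) ε (T x ω) < ENNReal.ofReal (s + 1) :=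
      hRx.trans_lt ((ENNReal.ofReal_lt_ofReal_iff (by linarith)).2 (by linarith))
    rw [Reps] at h1
    simp only [iInf_lt_iff] at h1
    obtain ⟨y, ⟨hy, z, hz, hVz⟩, hys⟩ := h1
    rw [ENNReal.ofReal_lt_ofReal_iff (by linarith)] at hys
    rw [← Function.comp_apply (f := T y), ← hT] at hVz
    rw [← hSR] at hy
    obtain ⟨l1, hl1⟩ := list_of_GpS hy
    have hzS : z ∈ S := by
      have : z ∈ (S : Set (Zd d)) := by rw [hSR]; exact hz
      exact this
    obtain ⟨l2, hl2⟩ := list_neg hneg (l1 ++ [⟨z, hzS⟩])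
    obtain ⟨a', ha', hal⟩ := hlen l1
    obtain ⟨b', hb', hbl⟩ := hlen l2
    obtain ⟨a, ha, hal2⟩ := list_lift (S := R) a'
      (fun w _ => (Finset.mem_filter.1 w.2).1)
    obtain ⟨b, hb, hbl2⟩ := list_lift (S := R) b'
      (fun w _ => (Finset.mem_filter.1 w.2).1)
    have hLa : LS a = y := by rw [ha, ha', hl1]
    have hLb : LS b = -(y + z) := by
      rw [hb, hb', hl2, LS_append, hl1]; simp [LS]
    rw [← hal2, hl1] at hal
    have hl2' : LS l2 = -(y + z) := by rw [← hb', ← hb, hLb]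
    rw [← hbl2, hl2', n1Z_neg] at hbl
    have hzR : z ∈ R := hz.1
    have hnz := n1Z_add_le y z
    have hDz := hD z hzR
    set L := (a ++ ⟨z, hzR⟩ :: b).length with hL
    have hLr : (L : ℝ) ≤ 2 * C * s + C * (D + 4) + 1 := by
      rw [hL]
      simp only [List.length_append, List.length_cons]
      push_cast
      have e1 : C * (n1Z y + 1) ≤ C * (s + 2) := mul_le_mul_of_nonneg_left (by linarith) hC
      have e2 : C * (n1Z (y + z) + 1) ≤ C * (s + D + 2) := mul_le_mul_of_nonneg_left (by linarith) hC
      nlinarith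
    have hK := KL_add_le (R := R) (wgt T V p ω) (fun z => ENNReal.ofReal (p z))
      (by rw [← ENNReal.ofReal_sum_of_nonneg (fun z hz => (hp z hz).1.le), hp1]; simp)
      (R0 R U₀) (fun u w hw => by simpa using wgt_le T V p ω u w 0 (hpos u w hw)) x
      (fun l hl => loop_R0 hU₀ l hl) (ENNReal.ofReal pm) (ENNReal.ofReal c)
      (fun w hw => ENNReal.ofReal_le_ofReal (hmin w hw))
      (by rw [← ENNReal.ofReal_one]; exact ENNReal.ofReal_le_ofReal hpm.2.le)
      (by rw [← ENNReal.ofReal_one]; exact ENNReal.ofReal_le_ofReal hc1.le)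
      ⟨z, hzR⟩ a b
      (by rw [hLa, add_comm x y]; exact wgt_le T V p ω (y + x) z ε hVz)
      (by rw [LS_append, LS, hLa, hLb]; simp) L le_rfl
    have e : ENNReal.ofReal pm ^ L * (1 - ENNReal.ofReal c) =
        ENNReal.ofReal (pm ^ L * (1 - c)) := by
      rw [ENNReal.ofReal_mul (pow_nonneg hpm.1.le _), ENNReal.ofReal_pow hpm.1.le,
        ENNReal.ofReal_sub _ hc0.le, ENNReal.ofReal_one]
    rw [e] at hK
    have hpL : 0 < pm ^ L := pow_pos hpm.1 _
    obtain ⟨r1, r2⟩ := log_of_q (R := R) _ (wgt_ne_top T V p ω) x _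
      (mul_pos hpL (by linarith)) hK
    refine ⟨r1, r2.trans ?_⟩
    rw [Real.log_mul hpL.ne' (by linarith), Real.log_pow]
    have hlog : Real.log pm < 0 := Real.log_neg hpm.1 hpm.2
    nlinarith
  intro ε' hε'
  have hlog : 0 < -Real.log pm := by linarith [Real.log_neg hpm.1 hpm.2]
  set lp := -Real.log pm
  set η := ε' / (2 * (2 * C * lp + 1))
  have hη : 0 < η := by positivity
  obtain ⟨M, hM⟩ := hR η hη
  set K := (C * (D + 4) + 1) * lp - Real.log (1 - c)
  refine ⟨max M (2 * K / ε'), fun x hx => ?_⟩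
  have hx0 : 0 ≤ n1Z x := n1_nonneg _
  obtain ⟨h1, h2⟩ := main x (η * n1Z x) (by positivity) (hM x ((le_max_left _ _).trans hx))
  refine ⟨h1, h2.trans ?_⟩
  have h3 : 2 * K ≤ n1Z x * ε' := by
    have := (le_max_right _ _).trans hx
    rwa [div_le_iff₀ hε'] at this
  have h4 : 2 * C * lp * η ≤ ε' / 2 := by
    have e1 : (2 * C * lp + 1) * η = ε' / 2 := by
      simp only [η]; field_simp
    linarith
  have h5 : 2 * C * lp * η * n1Z x ≤ ε' / 2 * n1Z x := by gcongr
  have h6 : (2 * C * (η * n1Z x) + C * (D + 4) + 1) * lp - Real.log (1 - c) =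
    2 * C * lp * η * n1Z x + K := by simp only [K]; ring
  rw [h6]
  linarith

end green
end RWRP

namespace RWRP

section bc

variable {d : ℕ} {Ω : Type*} [MeasurableSpace Ω]

theorem Reps_measurable (T : Zd d → Ω → Ω) (V : Ω → Zd d → ℝ) (S : Set (Zd d)) (ε : ℝ)
    (hT : ∀ z, Measurable (T z)) (hV : ∀ z, Measurable fun ω => V ω z) :
    Measurable (Reps T V S ε) := by
  have : Reps T V S ε = fun ω => ⨅ x : Zd d,
      (if x ∈ GpS S ∧ ∃ z ∈ S, ε ≤ V (T x ω) z then ENNReal.ofReal (n1Z x) else ⊤) := by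
    funext ω
    unfold Reps
    refine iInf_congr fun x => ?_
    by_cases h : x ∈ GpS S ∧ ∃ z ∈ S, ε ≤ V (T x ω) z
    · rw [if_pos h, iInf_pos h]
    · rw [if_neg h, iInf_neg h]
  rw [this]
  refine Measurable.iInf fun x => Measurable.ite ?_ measurable_const measurable_const
  have h1 : {ω | x ∈ GpS S ∧ ∃ z ∈ S, ε ≤ V (T x ω) z}
      = {ω : Ω | x ∈ GpS S} ∩ ⋃ z ∈ S, {ω | ε ≤ V (T x ω) z} := by
    ext ω; simp
  rw [h1]
  refine (MeasurableSet.const _).inter (MeasurableSet.biUnion (Set.to_countable S) fun z _ => ?_)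
  exact measurableSet_le measurable_const ((hV z).comp (hT x))

theorem count_bound (hd : d ≠ 0) (η : ℝ) (hη : 0 < η) (r : ℝ≥0∞) :
    ∑' x : Zd d, (if ENNReal.ofReal (η * n1Z x) < r then (1 : ℝ≥0∞) else 0)
      ≤ 2 ^ d * (ENNReal.ofReal (2 / η) ^ d * r ^ d + 1) := by
  by_cases hr : r = ⊤
  · have hc : ENNReal.ofReal (2 / η) ^ d ≠ 0 := by
      have : ENNReal.ofReal (2 / η) ≠ 0 := by simpa using by positivity
      exact pow_ne_zero _ this
    rw [hr, ENNReal.top_pow hd, ENNReal.mul_top hc, top_add, ENNReal.mul_top (by positivity)]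
    exact le_top
  set ρ := r.toReal
  set K := ⌊ρ / η⌋₊
  set F : Finset (Zd d) := Fintype.piFinset fun _ => Finset.Icc (-(K : ℤ)) K
  have hF : ∀ x ∉ F, (if ENNReal.ofReal (η * n1Z x) < r then (1 : ℝ≥0∞) else 0) = 0 := by
    intro x hx
    rw [if_neg]
    intro h
    apply hx
    rw [Fintype.mem_piFinset]
    intro i
    rw [Finset.mem_Icc, ← abs_le]
    have h1 : η * n1Z x < ρ := (ENNReal.ofReal_lt_iff_lt_toReal
      (mul_nonneg hη.le (n1_nonneg _)) hr).1 h
    have h2 : n1Z x ≤ ρ / η := by rw [le_div_iff₀ hη]; linarith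
    rw [nN_eq] at h2
    have h3 : nN x ≤ K := Nat.le_floor h2
    have h4 : (x i).natAbs ≤ nN x :=
      Finset.single_le_sum (f := fun i => (x i).natAbs) (fun _ _ => Nat.zero_le _)
        (Finset.mem_univ i)
    rw [Int.abs_eq_natAbs]
    exact_mod_cast h4.trans h3
  rw [tsum_eq_sum hF]
  have hcard : F.card = (2 * K + 1) ^ d := by
    rw [Fintype.card_piFinset]
    simp only [Int.card_Icc, Finset.prod_const, Finset.card_univ, Fintype.card_fin]
    congr 1
    omega
  have h5 : ∑ x ∈ F, (if ENNReal.ofReal (η * n1Z x) < r then (1 : ℝ≥0∞) else 0) ≤ F.card := by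
    calc _ ≤ ∑ x ∈ F, (1 : ℝ≥0∞) := Finset.sum_le_sum fun x _ => by split_ifs <;> simp
      _ = F.card := by simp
  refine h5.trans ?_
  rw [hcard]
  push_cast
  have hρ : 0 ≤ ρ := ENNReal.toReal_nonneg
  have hK : (2 * K : ℝ≥0∞) ≤ ENNReal.ofReal (2 / η) * r := by
    rw [← ENNReal.ofReal_toReal hr, ← ENNReal.ofReal_mul (by positivity)]
    have : (2 * K : ℝ≥0∞) = ENNReal.ofReal (2 * K) := by
      rw [ENNReal.ofReal_mul (by norm_num)]; simp
    rw [this]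
    apply ENNReal.ofReal_le_ofReal
    have := Nat.floor_le (div_nonneg hρ hη.le)
    calc (2 * (K : ℝ)) ≤ 2 * (ρ / η) := by linarith
      _ = 2 / η * ρ := by ring
  rw [← mul_pow]
  set b := ENNReal.ofReal (2 / η) * r
  have h6 : (2 * K + 1 : ℝ≥0∞) ≤ 2 * max b 1 := by
    rw [two_mul (max b 1)]
    exact add_le_add (hK.trans (le_max_left _ _)) (le_max_right _ _)
  calc (2 * K + 1 : ℝ≥0∞) ^ d ≤ (2 * max b 1) ^ d := pow_le_pow_left' h6 d
    _ = 2 ^ d * (max b 1) ^ d := mul_pow _ _ _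
    _ ≤ 2 ^ d * (b ^ d + 1) := by
      refine mul_le_mul_right ?_ _
      rcases le_total b 1 with h | h
      · rw [max_eq_right h, one_pow]; exact le_add_self
      · rw [max_eq_left h]; exact le_self_add

theorem reps_bc (ℙ : Measure Ω) [IsProbabilityMeasure ℙ] (T : Zd d → Ω → Ω)
    (V : Ω → Zd d → ℝ) (S : Set (Zd d)) (ε : ℝ) (hd : d ≠ 0)
    (hT : ∀ z, MeasurePreserving (T z) ℙ ℙ) (hV : ∀ z, Measurable fun ω => V ω z)
    (hfin : ∫⁻ ω, (Reps T V S ε ω) ^ d ∂ℙ < ⊤) :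
    ∀ᵐ ω ∂ℙ, ∀ η > (0 : ℝ), ∃ M : ℝ, ∀ x, M ≤ n1Z x →
      Reps T V S ε (T x ω) ≤ ENNReal.ofReal (η * n1Z x) := by
  have hm := Reps_measurable T V S ε (fun z => (hT z).measurable) hV
  have key : ∀ j : ℕ, ∀ᵐ ω ∂ℙ, ∃ M : ℝ, ∀ x, M ≤ n1Z x →
      Reps T V S ε (T x ω) ≤ ENNReal.ofReal ((1 / ((j : ℝ) + 1)) * n1Z x) := by
    intro j
    set η : ℝ := 1 / ((j : ℝ) + 1) with hηd
    have hη : 0 < η := by positivity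
    set B : Zd d → Set Ω := fun x => {ω | ENNReal.ofReal (η * n1Z x) < Reps T V S ε ω}
    have hB : ∀ x, MeasurableSet (B x) := fun x => measurableSet_lt measurable_const hm
    have hsum : ∑' x, ℙ (T x ⁻¹' B x) ≠ ⊤ := by
      have e1 : ∑' x, ℙ (T x ⁻¹' B x) = ∫⁻ ω, ∑' x : Zd d,
          (if ENNReal.ofReal (η * n1Z x) < Reps T V S ε ω then (1 : ℝ≥0∞) else 0) ∂ℙ := by
        rw [lintegral_tsum]
        · refine tsum_congr fun x => ?_
          rw [(hT x).measure_preimage (hB x).nullMeasurableSet, ← lintegral_indicator_one (hB x)]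
          refine lintegral_congr fun ω => ?_
          simp only [Set.indicator, B, Set.mem_ofPred_eq, Pi.one_apply]
        · intro x
          exact (Measurable.ite (hB x) measurable_const measurable_const).aemeasurable
      rw [e1]
      refine ne_top_of_le_ne_top ?_ (lintegral_mono fun ω => count_bound hd η hη _)
      rw [lintegral_const_mul' _ _ (by simp), lintegral_add_right _ measurable_const,
        lintegral_const_mul' _ _ (by simp)]
      refine ENNReal.mul_ne_top (by simp) (ENNReal.add_ne_top.2 ⟨?_, by simp⟩)
      exact ENNReal.mul_ne_top (by simp) hfin.ne
    filter_upwards [ae_finite_setOfPred_mem hsum] with ω hω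
    have hbd : BddAbove (n1Z '' {x | ω ∈ T x ⁻¹' B x}) := (hω.image _).bddAbove
    obtain ⟨M, hM⟩ := hbd
    refine ⟨M + 1, fun x hx => ?_⟩
    by_contra hc
    rw [not_le] at hc
    have := hM ⟨x, hc, rfl⟩
    linarith
  rw [← ae_all_iff] at key
  filter_upwards [key] with ω hω η hη
  obtain ⟨j, hj⟩ := exists_nat_one_div_lt hη
  obtain ⟨M, hM⟩ := hω j
  refine ⟨M, fun x hx => (hM x hx).trans (ENNReal.ofReal_le_ofReal ?_)⟩
  exact mul_le_mul_of_nonneg_right hj.le (n1_nonneg _)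

end bc
end RWRP


open RWRP in
/-- shape theorem for the Green's function. -/
theorem statement5
    {d : ℕ} {Ω : Type*} [MeasurableSpace Ω]
    (ℙ : Measure Ω) [IsProbabilityMeasure ℙ]
    (T : Zd d → Ω → Ω) (R : Finset (Zd d)) (V : Ω → Zd d → ℝ) (p : Zd d → ℝ)
    (hset : Setting ℙ T R V p)
    (hV1 : VplusL1 ℙ V R)
    (U₀ : Set (Fin d → ℝ)) (hU₀ : IsZeroFace R U₀)
    (hi : AssumptionI ℙ V R U₀)
    (A : Set (Fin d → ℝ)) (hA : IsFace (Cp R) A) (hAne : A ≠ {0})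
    (R' : Finset (Zd d)) (hR' : ∀ z, z ∈ R' ↔ z ∈ R ∧ toR z ∈ A)
    (hL : ∀ z ∈ R', z ≠ 0 → classL ℙ T (fun ω => max (V ω z) 0) z R')
    (hL0 : ∃ zh ∈ R', zh ≠ 0 ∧ classL ℙ T (fun ω => max (V ω 0) 0) zh R')
    (htr : retP p R < 1 ∨ ∃ ε > (0:ℝ), ∫⁻ ω, (Reps T V (R0 R U₀) ε ω) ^ d ∂ℙ < ⊤)
    (α : Ω → (Fin d → ℝ) → ℝ)
    (hα : ∀ᵐ ω ∂ℙ, ∀ ξ ∈ intrinsicInterior ℝ A, ∀ x : ℕ → Zd d,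
      (∀ n, x n ∈ Gp R ∧ toR (x n) ∈ A) →
      Tendsto (fun n : ℕ => (n : ℝ)⁻¹ • toR (x n)) atTop (𝓝 ξ) →
      Tendsto (fun n : ℕ => aFun T V p R ω 0 (x n) / n) atTop (𝓝 (α ω ξ)))
    :
    ∀ᵐ ω ∂ℙ, ∀ δ > (0:ℝ), ∀ ε > (0:ℝ), ∃ M : ℝ, ∀ x ∈ Gp R, toR x ∈ faceDelta A δ →
      M ≤ n1Z x →
      |Real.log ((greenK T V p R ω 0 x).toReal) + α ω (toR x)| ≤ ε * n1Z x := by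
  obtain ⟨hTm, hT0, hTadd, hTmp, hcard, hVm, hp, hp1⟩ := hset
  have hposae : ∀ᵐ ω ∂ℙ, ∀ x : Zd d, ∀ z ∈ R0 R U₀, 0 ≤ V (T x ω) z := by
    rw [ae_all_iff]
    intro x
    rw [ae_all_iff]
    intro z
    by_cases hz : z ∈ R0 R U₀
    · filter_upwards [(hTmp x).quasiMeasurePreserving.ae (hi.1 z hz)] with ω hω _
      exact hω
    · exact Eventually.of_forall fun ω h => absurd h hz
  have hd : d ≠ 0 := by
    rintro rfl
    have : R.card ≤ 1 := Finset.card_le_one_of_subsingleton R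
    omega
  have hdiag : ∀ᵐ ω ∂ℙ, DiagGood R (wgt T V p ω) := by
    rcases htr with h | ⟨ε, hε, hfin⟩
    · filter_upwards [hposae] with ω hω
      exact diag_transient T V p ω hU₀ hω h
    · filter_upwards [hposae, reps_bc ℙ T V (R0 R U₀) ε hd hTmp hVm hfin] with ω hω hω2
      exact diag_recurrent T hTadd V p hp hp1 ω hU₀ hω ε hε hω2
  filter_upwards [hα, hdiag] with ω hα hdg δ hδ ε hε
  obtain ⟨M1, hM1⟩ := shape hA (aFun T V p R ω 0) (α ω) hα δ hδ (ε / 2) (by positivity)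
  obtain ⟨M2, hM2⟩ := hdg (ε / 2) (by positivity)
  refine ⟨max M1 M2, fun x hx hxd hM => ?_⟩
  have h1 := hM1 x hx hxd ((le_max_left _ _).trans hM)
  obtain ⟨h2, h3⟩ := hM2 x ((le_max_right _ _).trans hM)
  have hx0 : x ≠ 0 := by
    rintro rfl
    apply hxd.2.1
    funext i
    simp [toR]
  have hn : 0 ≤ n1Z x := n1_nonneg _
  have hεn : 0 ≤ ε / 2 * n1Z x := by positivity
  have ha : aFun T V p R ω 0 x = - Real.log (walkK T V p R ω 0 x).toReal := by
    rw [aFun, if_neg hx0]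
  rw [greenK_eq, green_eq _ _ _ hx0, ← walkK_eq, ENNReal.toReal_mul]
  have hg1 : 1 ≤ (GRL R (wgt T V p ω) x x).toReal := by
    have := (ENNReal.toReal_le_toReal ENNReal.one_ne_top h2).2 (GRL_ge_one _ x)
    simpa using this
  have hl0 := Real.log_nonneg hg1
  rw [abs_le] at h1 ⊢
  by_cases hw : (walkK T V p R ω 0 x).toReal = 0
  · rw [hw] at ha ⊢
    simp only [Real.log_zero, neg_zero] at ha
    rw [ha] at h1
    rw [zero_mul, Real.log_zero]
    constructor <;> linarith [h1.1, h1.2]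
  · rw [Real.log_mul hw (by linarith)]
    rw [ha] at h1
    constructor <;> linarith [h1.1, h1.2]
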